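/- arXiv:1307.1339 — 10 statements merged into one kernel-verified Lean document; each statement's English description precedes it below -/
import Mathlib

section
/- If ε, η ∈ V satisfy ⟨ε,ε⟩ = ⟨η,η⟩ = 3 and ⟨ε,η⟩ = θ, then the triflections satisfy the Artin braid relation: t_ε ∘ t_η ∘ t_ε = t_η ∘ t_ε ∘ t_η. (Consequently assigning triflections to the nodes of a bipartite simply laced Coxeter diagram defines a representation of the corresponding Artin group.) -/
/-- If `ε, η` satisfy `⟨ε,ε⟩ = ⟨η,η⟩ = 3` and `⟨ε,η⟩ = θ`,
then the triflections satisfy the Artin braid relation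
`t_ε ∘ t_η ∘ t_ε = t_η ∘ t_ε ∘ t_η`. -/
theorem triflections_braid
    {V : Type*} [AddCommGroup V] [Module ℂ V]
    (B : V → V → ℂ)
    (hB_add : ∀ x y z : V, B (x + y) z = B x z + B y z)
    (hB_smul : ∀ (c : ℂ) (x z : V), B (c • x) z = c * B x z)
    (hB_herm : ∀ x y : V, B y x = starRingEnd ℂ (B x y))
    (ω θ : ℂ) (hω : ω = (-1 + Complex.I * Real.sqrt 3) / 2)
    (hθ : θ = Complex.I * Real.sqrt 3)
    (ε η : V) (hε : B ε ε = 3) (hη : B η η = 3) (hεη : B ε η = θ)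
    (tε tη : V → V)
    (htε : ∀ l : V, tε l = l + ((ω - 1) * (B l ε / 3)) • ε)
    (htη : ∀ l : V, tη l = l + ((ω - 1) * (B l η / 3)) • η) :
    tε ∘ tη ∘ tε = tη ∘ tε ∘ tη := by
  have hθ2 : θ ^ 2 + 3 = 0 := by
    have h3 : (Real.sqrt 3 : ℂ) ^ 2 = 3 := by
      exact_mod_cast Real.sq_sqrt (by norm_num : (0 : ℝ) ≤ 3)
    rw [hθ, mul_pow, Complex.I_sq, h3]
    ring
  have hηε : B η ε = -θ := by
    rw [hB_herm ε η, hεη, hθ]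
    simp
  obtain ⟨q, hq⟩ : ∃ q, q = ω - 1 := ⟨_, rfl⟩
  have hq2 : q ^ 2 + 3 * q + 3 = 0 := by
    have hqθ : q = (θ - 3) / 2 := by rw [hq, hω, hθ]; ring
    rw [hqθ]
    linear_combination hθ2 / 4
  funext l
  simp only [Function.comp_apply, htε, htη, hB_add, hB_smul, hε, hη, hεη, hηε, ← hq]
  match_scalars
  · ring
  · linear_combination q * B l ε / 9 * hq2 - q ^ 3 * B l ε / 27 * hθ2
  · linear_combination -(q * B l η / 9) * hq2 + q ^ 3 * B l η / 27 * hθ2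
end

section
/- The Hermitian matrix G_5 is positive semidefinite and has rank 4; equivalently, its kernel is one-dimensional. (The Hermitian form on the Eisenstein lattice L(A_5) has a one-dimensional kernel with positive definite quotient L(A_4).) -/
open scoped ComplexOrder

namespace AllcockStmt5

noncomputable section

/-- `θ = i√3`. -/
def θ : ℂ := Complex.I * Real.sqrt 3

/-- The Gram matrix `G_n` of the standard root basis of the Eisenstein lattice
`L(A_n)`. -/
def G (n : ℕ) : Matrix (Fin n) (Fin n) ℂ := fun j k =>
  if j = k then 3
  else if (j : ℕ) + 1 = (k : ℕ) then θ
  else if (k : ℕ) + 1 = (j : ℕ) then -θ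
  else 0

theorem θ_mul_self : θ * θ = -3 := by
  have h : (Real.sqrt 3 : ℂ) * Real.sqrt 3 = 3 := by
    rw [← Complex.ofReal_mul, Real.mul_self_sqrt (by norm_num)]
    norm_num
  calc θ * θ = (Complex.I * Complex.I) * ((Real.sqrt 3 : ℂ) * Real.sqrt 3) := by
        unfold θ; ring
    _ = -3 := by rw [h, Complex.I_mul_I]; norm_num

theorem star_θ : star θ = -θ := by
  simp [θ]

/-- The pivots of the `LDLᴴ` decomposition of `G 5`. -/
def pivots : Fin 5 → ℂ := ![3, 2, 3 / 2, 1, 0]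

/-- The upper unitriangular factor of the `LDLᴴ` decomposition of `G 5`. -/
def upperFactor : Matrix (Fin 5) (Fin 5) ℂ :=
  !![1, θ / 3, 0, 0, 0;
     0, 1, θ / 2, 0, 0;
     0, 0, 1, θ * (2 / 3), 0;
     0, 0, 0, 1, θ;
     0, 0, 0, 0, 1]

theorem isUnit_det_upperFactor : IsUnit upperFactor.det := by
  have h : upperFactor.BlockTriangular id := by
    intro i j hij
    fin_cases i <;> fin_cases j <;> simp [upperFactor] at hij ⊢
  rw [Matrix.det_of_isUpperTriangular h]
  simp [upperFactor, Fin.prod_univ_five]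

theorem G_five_eq :
    G 5 = upperFactor.conjTranspose * Matrix.diagonal pivots * upperFactor := by
  have hθ := θ_mul_self
  have hs : (starRingEnd ℂ) θ = -θ := star_θ
  ext i j
  rw [Matrix.mul_apply]
  simp only [Matrix.mul_diagonal, Matrix.conjTranspose_apply, Fin.sum_univ_five]
  fin_cases i <;> fin_cases j <;>
    simp [G, upperFactor, pivots, hs] <;> grind

/-- The Hermitian matrix `G_5` is positive semidefinite and has
rank `4`; equivalently, its kernel is one-dimensional. -/
theorem G_five_posSemidef_rank_four :
    (G 5).PosSemidef ∧ (G 5).rank = 4 := by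
  rw [G_five_eq]
  constructor
  · refine (Matrix.PosSemidef.diagonal fun i => ?_).conjTranspose_mul_mul_same upperFactor
    fin_cases i <;> simp [pivots]
    positivity
  · rw [Matrix.rank_mul_eq_left_of_isUnit_det _ _ isUnit_det_upperFactor,
      Matrix.rank_mul_eq_right_of_isUnit_det, Matrix.rank_diagonal, Fintype.card_subtype]
    · have h : (Finset.univ.filter fun i => pivots i ≠ 0) = {0, 1, 2, 3} := by
        ext i
        rw [Finset.mem_filter_univ]
        fin_cases i <;> simp [pivots]
      rw [h]
      rfl
    · rw [Matrix.det_conjTranspose]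
      exact isUnit_det_upperFactor.star

end

end AllcockStmt5
end

section
/- For every n with 6 ≤ n ≤ 10, the Hermitian matrix G_n is invertible and, counted with multiplicity, exactly n − 1 of its (necessarily real) eigenvalues are positive and exactly 1 is negative. (The Eisenstein lattice L(A_n) is Lorentzian for n = 6, …, 10.) -/
namespace AllcockStmt6

noncomputable section

/-- `θ = i√3`. -/
def θ : ℂ := Complex.I * Real.sqrt 3

/-- The Gram matrix `G_n` of the standard root basis of the Eisenstein lattice
`L(A_n)`. -/
def G (n : ℕ) : Matrix (Fin n) (Fin n) ℂ := fun j k =>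
  if j = k then 3
  else if (j : ℕ) + 1 = (k : ℕ) then θ
  else if (k : ℕ) + 1 = (j : ℕ) then -θ
  else 0

/-- The angle `(k + 1)π / (n + 1)`. -/
def angle (n k : ℕ) : ℝ := (k + 1) * Real.pi / (n + 1)

/-- The eigenvalue `3 + 2√3 cos ((k + 1)π / (n + 1))` of `G n`. -/
def eigenval (n k : ℕ) : ℝ := 3 + 2 * Real.sqrt 3 * Real.cos (angle n k)

/-- The eigenvector of `G n` with eigenvalue `eigenval n k`. -/
def eigenvec (n k : ℕ) : ℕ → ℂ := fun j =>
  (-Complex.I) ^ j * (Real.sin ((j + 1) * angle n k) : ℝ)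

theorem G_isHermitian (n : ℕ) : (G n).IsHermitian := by
  have hθ : star θ = -θ := by simp [θ]
  ext i j
  simp only [Matrix.conjTranspose_apply, G, Fin.ext_iff]
  split_ifs <;> first | omega | simp_all

theorem G_mulVec_apply (n : ℕ) (f : ℕ → ℂ) (hf : f n = 0) (j : Fin n) :
    (G n).mulVec (fun i => f i) j =
      3 * f j + θ * f (j + 1) - (if (j : ℕ) = 0 then 0 else θ * f (j - 1)) := by
  have h (k : Fin n) : G n j k * f k =
      (if (j : ℕ) = k then 3 * f k else 0) + (if (j : ℕ) + 1 = k then θ * f k else 0)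
        + (if (k : ℕ) + 1 = j then -θ * f k else 0) := by
    simp only [G, Fin.ext_iff]
    split_ifs <;> first | omega | simp
  have hj := j.2
  simp only [Matrix.mulVec, dotProduct, h]
  rw [Fin.sum_univ_eq_sum_range (fun k : ℕ =>
    (if (j : ℕ) = k then 3 * f k else 0) + (if (j : ℕ) + 1 = k then θ * f k else 0)
        + (if k + 1 = (j : ℕ) then -θ * f k else 0)) n]
  simp only [Finset.sum_add_distrib, Finset.sum_ite_eq, Finset.mem_range, hj, if_true]
  have h₁ : (if (j : ℕ) + 1 < n then θ * f (j + 1) else 0) = θ * f (j + 1) := by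
    split_ifs with hlt
    · rfl
    · rw [show (j : ℕ) + 1 = n by omega, hf, mul_zero]
  rw [h₁, sub_eq_add_neg]
  congr 1
  rcases Nat.eq_zero_or_pos (j : ℕ) with h0 | h0
  · simp [h0]
  · rw [if_neg h0.ne', Finset.sum_eq_single ((j : ℕ) - 1)]
    · rw [if_pos (by omega), neg_mul]
    · intro b _ hb
      rw [if_neg (by omega)]
    · intro hb
      exact absurd (Finset.mem_range.2 (by omega)) hb

theorem eigenvec_self (n k : ℕ) : eigenvec n k n = 0 := by
  have h : ((n : ℝ) + 1) * angle n k = ((k + 1 : ℕ) : ℝ) * Real.pi := by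
    unfold angle
    push_cast
    field_simp
  simp only [eigenvec, h, Real.sin_nat_mul_pi, Complex.ofReal_zero, mul_zero]

theorem G_mulVec_eigenvec (n k : ℕ) :
    (G n).mulVec (fun i => eigenvec n k i) =
      (eigenval n k : ℂ) • fun i : Fin n => eigenvec n k i := by
  funext j
  rw [G_mulVec_apply n _ (eigenvec_self n k)]
  obtain ⟨j, hj⟩ := j
  have hI := Complex.I_mul_I
  simp only [Pi.smul_apply, smul_eq_mul]
  rcases j with _ | j
  · have h : (((0 + 1 : ℕ) : ℝ) + 1) * angle n k = 2 * angle n k := by norm_num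
    simp only [eigenvec, eigenval, θ, h, if_true, Real.sin_two_mul]
    push_cast
    simp only [zero_add, pow_zero, pow_one, one_mul, sub_zero]
    linear_combination (-2 * (Real.sqrt 3 : ℂ) * Complex.sin (angle n k)
      * Complex.cos (angle n k)) * hI
  · have h₁ : (((j + 1 + 1 : ℕ) : ℝ) + 1) * angle n k
        = (((j + 1 : ℕ) : ℝ) + 1) * angle n k + angle n k := by push_cast; ring
    have h₂ : ((j : ℝ) + 1) * angle n k
        = (((j + 1 : ℕ) : ℝ) + 1) * angle n k - angle n k := by push_cast; ring
    simp only [eigenvec, eigenval, θ, Nat.add_sub_cancel, Nat.add_one_ne_zero, if_false, h₁, h₂,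
      Real.sin_add _ (angle n k), Real.sin_sub]
    generalize (((j + 1 : ℕ) : ℝ) + 1) * angle n k = x
    push_cast
    simp only [pow_succ]
    generalize (-Complex.I) ^ j = c
    generalize Complex.sin (x : ℂ) = a
    generalize Complex.cos (x : ℂ) = b
    generalize Complex.sin (angle n k : ℂ) = s
    generalize Complex.cos (angle n k : ℂ) = t
    linear_combination (Complex.I * (Real.sqrt 3 : ℂ) * c * (a * t + b * s)) * hI

theorem angle_mem_Ioo {n k : ℕ} (hk : k < n) : angle n k ∈ Set.Ioo 0 Real.pi := by
  have hk' : (k : ℝ) < n := by exact_mod_cast hk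
  unfold angle
  refine ⟨by positivity, ?_⟩
  rw [div_lt_iff₀ (by positivity), mul_comm]
  exact mul_lt_mul_of_pos_left (by linarith) Real.pi_pos

theorem eigenval_injective (n : ℕ) : Function.Injective fun k : Fin n => eigenval n k := by
  intro k l h
  have h3 : (0 : ℝ) < Real.sqrt 3 := by positivity
  have hcos : Real.cos (angle n k) = Real.cos (angle n l) := by
    have h' : 2 * Real.sqrt 3 * Real.cos (angle n k) = 2 * Real.sqrt 3 * Real.cos (angle n l) :=
      add_left_cancel h
    exact mul_left_cancel₀ (by positivity) h'
  have hang := Real.injOn_cos (Set.Ioo_subset_Icc_self (angle_mem_Ioo k.2))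
    (Set.Ioo_subset_Icc_self (angle_mem_Ioo l.2)) hcos
  unfold angle at hang
  have hpi := Real.pi_ne_zero
  field_simp at hang
  have : (k : ℕ) = l := by exact_mod_cast add_right_cancel hang
  exact Fin.ext this

theorem eigenval_mem_range (n : ℕ) (k : Fin n) :
    eigenval n k ∈ Set.range (G_isHermitian n).eigenvalues := by
  rw [← (G_isHermitian n).spectrum_real_eq_range_eigenvalues,
    ← spectrum.algebraMap_mem_iff ℂ, ← Matrix.spectrum_toLin']
  refine Module.End.HasEigenvalue.mem_spectrum
    (Module.End.hasEigenvalue_of_hasEigenvector (x := fun i : Fin n => eigenvec n k i) ⟨?_, ?_⟩)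
  · rw [Module.End.mem_eigenspace_iff, Matrix.toLin'_apply]
    exact G_mulVec_eigenvec n k
  · intro h0
    have hpos : 0 < n := k.pos
    have h := congrFun h0 ⟨0, hpos⟩
    have hs := Real.sin_pos_of_mem_Ioo (angle_mem_Ioo k.2)
    simp only [eigenvec, pow_zero, one_mul, Nat.cast_zero, zero_add, Pi.zero_apply,
      Complex.ofReal_eq_zero] at h
    exact hs.ne' h

/-- Up to reordering, the eigenvalues of `G n` are the numbers `eigenval n k`, `k < n`. -/
theorem exists_perm_eigenvalues (n : ℕ) :
    ∃ σ : Equiv.Perm (Fin n), ∀ k, (G_isHermitian n).eigenvalues (σ k) = eigenval n k := by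
  choose f hf using eigenval_mem_range n
  have hinj : Function.Injective f := fun a b hab =>
    eigenval_injective n (by simp only [← hf, hab])
  exact ⟨Equiv.ofBijective f (Finite.injective_iff_bijective.1 hinj), hf⟩

theorem card_filter_eigenvalues (n : ℕ) (p : ℝ → Prop) [DecidablePred p] :
    (Finset.univ.filter fun i => p ((G_isHermitian n).eigenvalues i)).card =
      (Finset.univ.filter fun k : Fin n => p (eigenval n k)).card := by
  obtain ⟨σ, hσ⟩ := exists_perm_eigenvalues n
  symm
  refine Finset.card_bij (fun k _ => σ k) ?_ (fun _ _ _ _ h => σ.injective h) ?_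
  · intro k hk
    simpa [hσ] using hk
  · intro i hi
    refine ⟨σ.symm i, ?_, by simp⟩
    rw [Finset.mem_filter] at hi ⊢
    refine ⟨Finset.mem_univ _, ?_⟩
    rw [← hσ, Equiv.apply_symm_apply]
    exact hi.2

theorem cos_five_pi_div_six : Real.cos (5 * Real.pi / 6) = -(Real.sqrt 3 / 2) := by
  rw [show 5 * Real.pi / 6 = Real.pi - Real.pi / 6 by ring, Real.cos_pi_sub, Real.cos_pi_div_six]

theorem eigenval_pos {n k : ℕ} (hk : k < n) (h : 6 * (k + 1) < 5 * (n + 1)) :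
    0 < eigenval n k := by
  have h' : 6 * ((k : ℝ) + 1) < 5 * (n + 1) := by exact_mod_cast h
  have hlt : angle n k < 5 * Real.pi / 6 := by
    unfold angle
    rw [div_lt_div_iff₀ (by positivity) (by norm_num)]
    nlinarith [Real.pi_pos]
  have hcos := Real.cos_lt_cos_of_nonneg_of_le_pi (angle_mem_Ioo hk).1.le
    (by linarith [Real.pi_pos]) hlt
  rw [cos_five_pi_div_six] at hcos
  have h3 : (0 : ℝ) < Real.sqrt 3 := by positivity
  have hsq : Real.sqrt 3 * Real.sqrt 3 = 3 := Real.mul_self_sqrt (by norm_num)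
  unfold eigenval
  nlinarith

theorem eigenval_neg {n k : ℕ} (hk : k < n) (h : 5 * (n + 1) < 6 * (k + 1)) :
    eigenval n k < 0 := by
  have h' : 5 * ((n : ℝ) + 1) < 6 * (k + 1) := by exact_mod_cast h
  have hlt : 5 * Real.pi / 6 < angle n k := by
    unfold angle
    rw [div_lt_div_iff₀ (by norm_num) (by positivity)]
    nlinarith [Real.pi_pos]
  have hcos := Real.cos_lt_cos_of_nonneg_of_le_pi (by positivity) (angle_mem_Ioo hk).2.le hlt
  rw [cos_five_pi_div_six] at hcos
  have h3 : (0 : ℝ) < Real.sqrt 3 := by positivity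
  have hsq : Real.sqrt 3 * Real.sqrt 3 = 3 := Real.mul_self_sqrt (by norm_num)
  unfold eigenval
  nlinarith

/-- For every `n` with `6 ≤ n ≤ 10`, the Hermitian matrix `G_n`
is invertible and, counted with multiplicity, exactly `n - 1` of its
(necessarily real) eigenvalues are positive and exactly `1` is negative.
(`L(A_n)` is Lorentzian for `n = 6, …, 10`.) -/
theorem G_lorentzian_of_six_le :
    ∀ n : ℕ, 6 ≤ n → n ≤ 10 →
    ∃ hH : (G n).IsHermitian,
      IsUnit (G n).det ∧
      (Finset.univ.filter fun i => 0 < hH.eigenvalues i).card = n - 1 ∧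
      (Finset.univ.filter fun i => hH.eigenvalues i < 0).card = 1 := by
  intro n h6 h10
  have hpos (k : Fin n) (hk : (k : ℕ) + 1 < n) : 0 < eigenval n k :=
    eigenval_pos k.2 (by omega)
  have hneg (k : Fin n) (hk : ¬ (k : ℕ) + 1 < n) : eigenval n k < 0 :=
    eigenval_neg k.2 (by have := k.2; omega)
  have hposiff (k : Fin n) : 0 < eigenval n k ↔ k ≠ ⟨n - 1, by omega⟩ := by
    have hk := k.2
    rw [ne_eq, Fin.ext_iff]
    refine ⟨fun h he => ?_, fun h => hpos k (by simp only at h; omega)⟩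
    exact (hneg k (by simp only at he; omega)).not_gt h
  have hnegiff (k : Fin n) : eigenval n k < 0 ↔ k = ⟨n - 1, by omega⟩ := by
    have hk := k.2
    rw [Fin.ext_iff]
    refine ⟨fun h => ?_, fun h => hneg k (by simp only at h; omega)⟩
    by_contra he
    exact (hpos k (by simp only at he; omega)).not_gt h
  refine ⟨G_isHermitian n, ?_, ?_, ?_⟩
  · rw [isUnit_iff_ne_zero, (G_isHermitian n).det_eq_prod_eigenvalues, Finset.prod_ne_zero_iff]
    intro i _
    obtain ⟨σ, hσ⟩ := exists_perm_eigenvalues n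
    obtain ⟨k, rfl⟩ := σ.surjective i
    rw [hσ]
    refine Complex.ofReal_ne_zero.2 ?_
    by_cases hk : (k : ℕ) + 1 < n
    · exact (hpos k hk).ne'
    · exact (hneg k hk).ne
  · rw [card_filter_eigenvalues n (fun x => 0 < x)]
    simp only [hposiff, Finset.filter_ne', Finset.card_erase_of_mem (Finset.mem_univ _),
      Finset.card_univ, Fintype.card_fin]
  · rw [card_filter_eigenvalues n (fun x => x < 0)]
    simp only [hnegiff, Finset.filter_eq', Finset.mem_univ, if_true, Finset.card_singleton]

end

end AllcockStmt6
end

section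
/- The Hermitian matrix G_11 has rank 10 and, counted with multiplicity, exactly 9 of its (necessarily real) eigenvalues are positive, exactly 1 is negative, and exactly 1 is zero. (The Hermitian form on the Eisenstein lattice L(A_11) has a one-dimensional kernel with Lorentzian quotient the Deligne–Mostow lattice L(A_10).) -/
namespace AllcockStmt7

noncomputable section

/-- `θ = i√3`. -/
def θ : ℂ := Complex.I * Real.sqrt 3

/-- The Gram matrix `G_n` of the standard root basis of the Eisenstein lattice
`L(A_n)`. -/
def G (n : ℕ) : Matrix (Fin n) (Fin n) ℂ := fun j k =>
  if j = k then 3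
  else if (j : ℕ) + 1 = (k : ℕ) then θ
  else if (k : ℕ) + 1 = (j : ℕ) then -θ
  else 0

/-- The matrix `G_n` is Hermitian. -/
theorem isHermitian_G (n : ℕ) : (G n).IsHermitian := by
  have hθ : star θ = -θ := by simp [θ]
  ext j k
  rw [Matrix.conjTranspose_apply]
  simp only [G, Fin.ext_iff]
  split_ifs <;> first | omega | simp [hθ]

/-- `G_n` acts on a sequence vanishing at `0` and `n + 1` as a three-term recurrence. -/
theorem G_mulVec_apply {n : ℕ} {w : ℕ → ℂ} (h0 : w 0 = 0) (hn : w (n + 1) = 0) (j : Fin n) :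
    (G n).mulVec (fun k => w (k + 1)) j = 3 * w (j + 1) + θ * w (j + 2) - θ * w j := by
  obtain ⟨j, hj⟩ := j
  have hG : ∀ k : Fin n, G n ⟨j, hj⟩ k * w (k + 1) =
      (if j = (k : ℕ) then 3 * w (k + 1) else 0) + (if j + 1 = (k : ℕ) then θ * w (k + 1) else 0) -
        (if j = (k : ℕ) + 1 then θ * w (k + 1) else 0) := by
    intro k
    simp only [G, Fin.ext_iff]
    split_ifs <;> first | omega | ring
  simp only [Matrix.mulVec, dotProduct, hG]
  rw [Fin.sum_univ_eq_sum_range (fun k => (if j = k then 3 * w (k + 1) else 0) +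
    (if j + 1 = k then θ * w (k + 1) else 0) - (if j = k + 1 then θ * w (k + 1) else 0)),
    Finset.sum_sub_distrib, Finset.sum_add_distrib, Finset.sum_ite_eq, Finset.sum_ite_eq]
  have h1 : (if j + 1 ∈ Finset.range n then θ * w (j + 1 + 1) else 0) = θ * w (j + 2) := by
    split_ifs with h
    · rfl
    · obtain rfl : n = j + 1 := by simp at h; omega
      simp [hn]
  have h2 : ∑ k ∈ Finset.range n, (if j = k + 1 then θ * w (k + 1) else 0) = θ * w j := by
    cases j with
    | zero => simp [h0]
    | succ i =>
      simp only [Nat.add_right_cancel_iff, Finset.sum_ite_eq]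
      rw [if_pos (by simp; omega)]
  rw [h1, h2, if_pos (by simpa using hj)]

/-- The numbers `3 + 2 √3 cos (kπ / (n + 1))`, `1 ≤ k ≤ n`, indexed from `0`. -/
def eig (n : ℕ) (k : Fin n) : ℝ :=
  3 + 2 * √3 * Real.cos ((k + 1 : ℕ) * (Real.pi / (n + 1)))

theorem eig_angle_mem {n : ℕ} (k : Fin n) :
    ((k + 1 : ℕ) * (Real.pi / (n + 1)) : ℝ) ∈ Set.Ioo 0 Real.pi := by
  have hpi := Real.pi_pos
  have hk : ((k + 1 : ℕ) : ℝ) < n + 1 := by exact_mod_cast Nat.succ_lt_succ k.2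
  refine ⟨by positivity, ?_⟩
  rw [← mul_div_assoc, div_lt_iff₀ (by positivity), mul_comm]
  gcongr

theorem eig_strictAnti (n : ℕ) : StrictAnti (eig n) := by
  intro k l hkl
  have hpi := Real.pi_pos
  have hlt : (k : ℕ) < l := hkl
  have h : Real.cos ((l + 1 : ℕ) * (Real.pi / (n + 1))) <
      Real.cos ((k + 1 : ℕ) * (Real.pi / (n + 1))) := by
    apply Real.strictAntiOn_cos (Set.Ioo_subset_Icc_self (eig_angle_mem k))
      (Set.Ioo_subset_Icc_self (eig_angle_mem l))
    gcongr
  unfold eig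
  gcongr

/-- Each `eig n k` is an eigenvalue of `G_n`. -/
theorem hasEigenvalue_eig {n : ℕ} (k : Fin n) :
    Module.End.HasEigenvalue (Matrix.toLin' (G n)) (eig n k : ℂ) := by
  set φ : ℝ := (k + 1 : ℕ) * (Real.pi / (n + 1)) with hφ
  let w : ℕ → ℂ := fun j => (-Complex.I) ^ j * (Real.sin (j * φ) : ℝ)
  have h0 : w 0 = 0 := by simp [w]
  have hn : w (n + 1) = 0 := by
    have : ((n + 1 : ℕ) : ℝ) * φ = (k + 1 : ℕ) * Real.pi := by
      rw [hφ]; push_cast; field_simp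
    simp only [w, this, Real.sin_nat_mul_pi]
    simp
  apply Module.End.hasEigenvalue_of_hasEigenvector (x := fun j : Fin n => w (j + 1))
  refine ⟨Module.End.mem_eigenspace_iff.mpr ?_, fun h => ?_⟩
  · ext j
    rw [Matrix.toLin'_apply, G_mulVec_apply h0 hn, Pi.smul_apply, smul_eq_mul]
    have hs : Real.sin ((j + 2 : ℕ) * φ) =
        2 * Real.cos φ * Real.sin ((j + 1 : ℕ) * φ) - Real.sin ((j : ℕ) * φ) := by
      have e1 : ((j + 2 : ℕ) : ℝ) * φ = (j + 1 : ℕ) * φ + φ := by push_cast; ring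
      have e2 : ((j : ℕ) : ℝ) * φ = (j + 1 : ℕ) * φ - φ := by push_cast; ring
      rw [e1, e2, Real.sin_add, Real.sin_sub]
      ring
    simp only [w, hs, eig, θ, ← hφ, pow_succ]
    push_cast
    linear_combination (-Complex.I) ^ (j : ℕ) * Complex.I * (√3 : ℝ) *
      (2 * Complex.cos φ * Complex.sin ((j + 1) * φ) - Complex.sin (j * φ)) * Complex.I_sq
  · have hpos : 0 < n := k.pos
    have hzero := congrFun h ⟨0, hpos⟩
    have hsin : Real.sin φ ≠ 0 :=
      (Real.sin_pos_of_mem_Ioo (eig_angle_mem k)).ne'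
    have hsinc : (Real.sin φ : ℂ) ≠ 0 := by exact_mod_cast hsin
    simp [w] at hzero
    exact hsinc (by simpa using hzero)

/-- The eigenvalues of `G_n` are, up to a permutation, the numbers `eig n k`. -/
theorem exists_perm_eigenvalues_G {n : ℕ} (hH : (G n).IsHermitian) :
    ∃ e : Equiv.Perm (Fin n), ∀ k, hH.eigenvalues (e k) = eig n k := by
  have h : ∀ k, ∃ i, hH.eigenvalues i = eig n k := by
    intro k
    have hk := (hasEigenvalue_eig k).mem_spectrum
    rw [Matrix.spectrum_toLin', hH.spectrum_eq_image_range] at hk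
    obtain ⟨_, ⟨i, rfl⟩, hi⟩ := hk
    exact ⟨i, Complex.ofReal_injective hi⟩
  choose f hf using h
  have hinj : Function.Injective f := fun a b hab =>
    (eig_strictAnti n).injective (by rw [← hf, ← hf, hab])
  exact ⟨Equiv.ofBijective f (Finite.injective_iff_bijective.mp hinj), hf⟩

theorem card_filter_eigenvalues_G {n : ℕ} (hH : (G n).IsHermitian) (p : ℝ → Prop)
    [DecidablePred p] :
    (Finset.univ.filter fun i => p (hH.eigenvalues i)).card =
      (Finset.univ.filter fun k => p (eig n k)).card := by
  obtain ⟨e, he⟩ := exists_perm_eigenvalues_G hH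
  refine (Finset.card_equiv e fun k => ?_).symm
  simp [he]

theorem eig_eleven_nine : eig 11 9 = 0 := by
  have h : (((9 : Fin 11) : ℕ) + 1 : ℕ) * (Real.pi / ((11 : ℕ) + 1)) = Real.pi - Real.pi / 6 := by
    norm_num
    ring
  have h3 : √(3 : ℝ) * √3 = 3 := Real.mul_self_sqrt (by norm_num)
  rw [eig, h, Real.cos_pi_sub, Real.cos_pi_div_six]
  linear_combination -h3

/-- The Hermitian matrix `G_11` has rank `10` and, counted with
multiplicity, exactly `9` of its (necessarily real) eigenvalues are positive,
exactly `1` is negative, and exactly `1` is zero. -/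
theorem G_eleven_rank_and_signature :
    ∃ hH : (G 11).IsHermitian,
      (G 11).rank = 10 ∧
      (Finset.univ.filter fun i => 0 < hH.eigenvalues i).card = 9 ∧
      (Finset.univ.filter fun i => hH.eigenvalues i < 0).card = 1 ∧
      (Finset.univ.filter fun i => hH.eigenvalues i = 0).card = 1 := by
  have hH := isHermitian_G 11
  have hpos (k : Fin 11) : 0 < eig 11 k ↔ k < 9 := by
    rw [← eig_eleven_nine, (eig_strictAnti 11).lt_iff_gt]
  have hneg (k : Fin 11) : eig 11 k < 0 ↔ 9 < k := by
    rw [← eig_eleven_nine, (eig_strictAnti 11).lt_iff_gt]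
  have hzero (k : Fin 11) : eig 11 k = 0 ↔ k = 9 := by
    rw [← eig_eleven_nine, (eig_strictAnti 11).injective.eq_iff]
  refine ⟨hH, ?_, ?_, ?_, ?_⟩
  · rw [hH.rank_eq_card_non_zero_eigs, Fintype.card_subtype,
      card_filter_eigenvalues_G hH (· ≠ 0)]
    simp only [ne_eq, hzero]
    decide
  · rw [card_filter_eigenvalues_G hH (0 < ·)]
    simp only [hpos]
    decide
  · rw [card_filter_eigenvalues_G hH (· < 0)]
    simp only [hneg]
    decide
  · rw [card_filter_eigenvalues_G hH (· = 0)]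
    simp only [hzero]
    decide

end

end AllcockStmt7
end

section
/- The Hermitian matrix G̃ has rank 10 and, counted with multiplicity, exactly 9 of its (necessarily real) eigenvalues are positive, exactly 1 is negative, and exactly 2 are zero. (The Hermitian form on the Eisenstein lattice L(Ã_11) of the affine diagram Ã_11, the free 12-gon, has a two-dimensional kernel with quotient the Deligne–Mostow lattice L(A_10).) -/
namespace AllcockStmt8

noncomputable section

/-- `θ = i√3`. -/
def θ : ℂ := Complex.I * Real.sqrt 3

/-- The Gram matrix `G̃` of the standard root basis of the Eisenstein lattice
`L(Ã_11)` of the affine Coxeter diagram `Ã_11` (a 12-cycle), with rows and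
columns indexed cyclically by `ℤ/12ℤ`: diagonal entries `3`, entry `θ` in
position `(j, j+1)` and `-θ` in position `(j+1, j)`, all other entries `0`. -/
def Gaff : Matrix (ZMod 12) (ZMod 12) ℂ := fun j k =>
  if j = k then 3
  else if k = j + 1 then θ
  else if j = k + 1 then -θ
  else 0

/-- If a Hermitian matrix is diagonalized by an invertible matrix with real diagonal `μ`, then `μ`
lists its eigenvalues with multiplicity. -/
theorem map_eigenvalues_eq_of_mul_eq {n : Type*} [Fintype n] [DecidableEq n]
    {A P Q : Matrix n n ℂ} (hA : A.IsHermitian) (μ : n → ℝ) (hPQ : P * Q = 1)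
    (h : A * P = P * Matrix.diagonal fun i => (μ i : ℂ)) :
    Finset.univ.val.map hA.eigenvalues = Finset.univ.val.map μ := by
  have hc : A.charpoly = (Matrix.diagonal fun i => (μ i : ℂ)).charpoly := by
    have hA' : A = P * ((Matrix.diagonal fun i => (μ i : ℂ)) * Q) := by
      rw [← mul_assoc, ← h, mul_assoc, hPQ, mul_one]
    rw [hA', Matrix.charpoly_mul_comm, mul_assoc, mul_eq_one_comm.mp hPQ, mul_one]
  have hr := hA.roots_charpoly_eq_eigenvalues
  rw [hc, Matrix.charpoly_diagonal, Polynomial.roots_prod _ _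
    (Finset.prod_ne_zero_iff.mpr fun i _ => Polynomial.X_sub_C_ne_zero _)] at hr
  have hr' := congrArg (Multiset.map Complex.re) hr
  simpa [Function.comp_def] using hr'.symm

theorem card_filter_eq_of_map_eq {n α : Type*} [Fintype n] {f g : n → α}
    (h : Finset.univ.val.map f = Finset.univ.val.map g) (p : α → Prop) [DecidablePred p] :
    (Finset.univ.filter fun i => p (f i)).card = (Finset.univ.filter fun i => p (g i)).card := by
  have := congrArg (Multiset.countP p) h
  rwa [Multiset.countP_map, Multiset.countP_map] at this

theorem star_θ : star θ = -θ := by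
  simp [θ]

theorem Gaff_eq (j k : ZMod 12) :
    Gaff j k = (if k = j then 3 else 0) + (if k = j + 1 then θ else 0)
      + (if k = j - 1 then -θ else 0) := by
  have h₁ : ∀ j : ZMod 12, j ≠ j + 1 := by decide
  have h₂ : ∀ j : ZMod 12, j ≠ j - 1 := by decide
  have h₃ : ∀ j : ZMod 12, j + 1 ≠ j - 1 := by decide
  unfold Gaff
  by_cases h : j = k
  · subst h
    simp [h₁ j, h₂ j]
  by_cases h' : k = j + 1
  · subst h'
    simp [h₁ j, (h₁ j).symm, h₃ j]
  · simp [h, h', Ne.symm h, eq_sub_iff_add_eq, eq_comm]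

theorem Gaff_isHermitian : Gaff.IsHermitian := by
  ext j k
  rw [Matrix.conjTranspose_apply, Gaff_eq, Gaff_eq]
  have e₁ : (k = j + 1) ↔ (j = k - 1) := by rw [eq_sub_iff_add_eq, eq_comm]
  have e₂ : (k = j - 1) ↔ (j = k + 1) := by rw [eq_sub_iff_add_eq, eq_comm]
  simp only [star_add, apply_ite star, star_neg, star_θ, star_zero, neg_neg, ← e₁, ← e₂,
    eq_comm (a := j) (b := k), star_ofNat]
  ring

/-- The discrete Fourier matrix of `ℤ/Nℤ`. -/
def dft (N : ℕ) [NeZero N] : Matrix (ZMod N) (ZMod N) ℂ := fun j k => ZMod.stdAddChar (j * k)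

theorem dft_mul_inverse (N : ℕ) [NeZero N] :
    dft N * Matrix.of (fun j k => (N : ℂ)⁻¹ * ZMod.stdAddChar (-(j * k))) = 1 := by
  ext j k
  have hN : (N : ℂ) ≠ 0 := NeZero.ne _
  have h := AddChar.sum_mulShift (j - k) (ZMod.isPrimitive_stdAddChar N)
  simp only [Matrix.mul_apply, dft, Matrix.of_apply, Matrix.one_apply]
  have e : ∀ l : ZMod N, (ZMod.stdAddChar (j * l) : ℂ) * ((N : ℂ)⁻¹ * ZMod.stdAddChar (-(l * k)))
      = (N : ℂ)⁻¹ * ZMod.stdAddChar (l * (j - k)) := fun l => by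
    rw [mul_left_comm, ← AddChar.map_add_eq_mul]
    ring_nf
  rw [Finset.sum_congr rfl fun l _ => e l, ← Finset.mul_sum, h]
  by_cases hjk : j = k <;> simp [hjk, sub_eq_zero, hN]

/-- The eigenvalue of `Gaff` on the `k`-th character of `ℤ/12ℤ`. -/
def eigen (k : ZMod 12) : ℝ := 3 - 2 * √3 * Real.sin (k.val * (Real.pi / 6))

theorem stdAddChar_twelve (k : ZMod 12) :
    (ZMod.stdAddChar k : ℂ) =
      Complex.cos (k.val * (Real.pi / 6)) + Complex.sin (k.val * (Real.pi / 6)) * Complex.I := by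
  rw [ZMod.stdAddChar_apply, ZMod.toCircle_apply, ← Complex.exp_mul_I]
  congr 1
  push_cast
  ring

theorem eigen_eq (k : ZMod 12) :
    (eigen k : ℂ) = 3 + θ * ZMod.stdAddChar k - θ * ZMod.stdAddChar (-k) := by
  have hinv : (ZMod.stdAddChar (-k) : ℂ) =
      Complex.cos (k.val * (Real.pi / 6)) - Complex.sin (k.val * (Real.pi / 6)) * Complex.I := by
    rw [AddChar.map_neg_eq_inv, stdAddChar_twelve, inv_eq_iff_eq_inv]
    refine eq_inv_of_mul_eq_one_left ?_
    linear_combination Complex.sin_sq_add_cos_sq (k.val * (Real.pi / 6))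
      - Complex.sin (k.val * (Real.pi / 6)) ^ 2 * Complex.I_sq
  rw [hinv, stdAddChar_twelve, eigen, θ]
  push_cast
  linear_combination (-2 * (√3 : ℂ) * Complex.sin (k.val * (Real.pi / 6))) * Complex.I_sq

theorem Gaff_mul_dft : Gaff * dft 12 = dft 12 * Matrix.diagonal fun k => (eigen k : ℂ) := by
  ext j k
  rw [Matrix.mul_diagonal, Matrix.mul_apply, eigen_eq]
  simp only [Gaff_eq, add_mul, Finset.sum_add_distrib, ite_mul, zero_mul, Finset.sum_ite_eq',
    Finset.mem_univ, if_true, dft, one_mul, sub_eq_add_neg, neg_mul,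
    AddChar.map_add_eq_mul]
  ring

theorem eigen_two : eigen 2 = 0 := by
  have h : ((2 : ZMod 12).val : ℝ) * (Real.pi / 6) = Real.pi / 3 := by
    rw [show (2 : ZMod 12).val = 2 from rfl]; push_cast; ring
  rw [eigen, h, Real.sin_pi_div_three]
  linarith [Real.mul_self_sqrt (show (0 : ℝ) ≤ 3 by norm_num)]

theorem eigen_four : eigen 4 = 0 := by
  have h : ((4 : ZMod 12).val : ℝ) * (Real.pi / 6) = Real.pi - Real.pi / 3 := by
    rw [show (4 : ZMod 12).val = 4 from rfl]; push_cast; ring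
  rw [eigen, h, Real.sin_pi_sub, Real.sin_pi_div_three]
  linarith [Real.mul_self_sqrt (show (0 : ℝ) ≤ 3 by norm_num)]

theorem eigen_three : eigen 3 < 0 := by
  have h : ((3 : ZMod 12).val : ℝ) * (Real.pi / 6) = Real.pi / 2 := by
    rw [show (3 : ZMod 12).val = 3 from rfl]; push_cast; ring
  rw [eigen, h, Real.sin_pi_div_two]
  nlinarith [Real.mul_self_sqrt (show (0 : ℝ) ≤ 3 by norm_num), Real.sqrt_nonneg 3]

theorem eigen_pos_of_sin_le {k : ZMod 12} (h : Real.sin (k.val * (Real.pi / 6)) ≤ 1 / 2) :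
    0 < eigen k := by
  rw [eigen]
  nlinarith [Real.mul_self_sqrt (show (0 : ℝ) ≤ 3 by norm_num), Real.sqrt_nonneg 3]

theorem eigen_pos {k : ZMod 12} (h₂ : k ≠ 2) (h₃ : k ≠ 3) (h₄ : k ≠ 4) : 0 < eigen k := by
  apply eigen_pos_of_sin_le
  have hv : k.val ≤ 1 ∨ k.val = 5 ∨ 6 ≤ k.val ∧ k.val ≤ 12 := by
    revert k; decide
  have hπ := Real.pi_pos
  rw [← Real.sin_pi_div_six]
  rcases hv with h | h | ⟨h, h'⟩
  · have : (k.val : ℝ) ≤ 1 := by exact_mod_cast h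
    have : (0 : ℝ) ≤ k.val := by positivity
    apply Real.sin_le_sin_of_le_of_le_pi_div_two <;> nlinarith
  · rw [h, ← Real.sin_pi_sub]
    apply le_of_eq
    congr 1
    push_cast
    ring
  · have h6 : (6 : ℝ) ≤ k.val := by exact_mod_cast h
    have h12 : (k.val : ℝ) ≤ 12 := by exact_mod_cast h'
    have hs : 0 ≤ Real.sin (k.val * (Real.pi / 6) - Real.pi) :=
      Real.sin_nonneg_of_nonneg_of_le_pi (by nlinarith) (by nlinarith)
    rw [Real.sin_sub_pi] at hs
    rw [Real.sin_pi_div_six]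
    linarith

theorem eigen_eq_zero_iff (k : ZMod 12) : eigen k = 0 ↔ k = 2 ∨ k = 4 := by
  refine ⟨fun h => ?_, ?_⟩
  · by_contra! hk
    rcases eq_or_ne k 3 with rfl | h₃
    · exact eigen_three.ne h
    · exact (eigen_pos hk.1 h₃ hk.2).ne' h
  · rintro (rfl | rfl)
    exacts [eigen_two, eigen_four]

theorem eigen_neg_iff (k : ZMod 12) : eigen k < 0 ↔ k = 3 := by
  refine ⟨fun h => ?_, fun h => h ▸ eigen_three⟩
  by_contra h₃
  have h0 := mt (eigen_eq_zero_iff k).mpr h.ne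
  push Not at h0
  exact (eigen_pos h0.1 h₃ h0.2).not_gt h

theorem eigen_pos_iff (k : ZMod 12) : 0 < eigen k ↔ k ≠ 2 ∧ k ≠ 3 ∧ k ≠ 4 := by
  refine ⟨fun h => ⟨?_, ?_, ?_⟩, fun h => eigen_pos h.1 h.2.1 h.2.2⟩
  · rintro rfl
    exact h.ne' eigen_two
  · rintro rfl
    exact h.not_gt eigen_three
  · rintro rfl
    exact h.ne' eigen_four

/-- The Hermitian matrix `G̃` has rank `10` and, counted with
multiplicity, exactly `9` of its (necessarily real) eigenvalues are positive,
exactly `1` is negative, and exactly `2` are zero. -/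
theorem Gaff_rank_and_signature :
    ∃ hH : Gaff.IsHermitian,
      Gaff.rank = 10 ∧
      (Finset.univ.filter fun i => 0 < hH.eigenvalues i).card = 9 ∧
      (Finset.univ.filter fun i => hH.eigenvalues i < 0).card = 1 ∧
      (Finset.univ.filter fun i => hH.eigenvalues i = 0).card = 2 := by
  have hm := map_eigenvalues_eq_of_mul_eq Gaff_isHermitian eigen (dft_mul_inverse 12) Gaff_mul_dft
  refine ⟨Gaff_isHermitian, ?_, ?_, ?_, ?_⟩
  · rw [Gaff_isHermitian.rank_eq_card_non_zero_eigs, Fintype.card_subtype,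
      card_filter_eq_of_map_eq hm (· ≠ 0)]
    simp only [ne_eq, eigen_eq_zero_iff]
    decide
  · rw [card_filter_eq_of_map_eq hm (0 < ·)]
    simp only [eigen_pos_iff]
    decide
  · rw [card_filter_eq_of_map_eq hm (· < 0)]
    simp only [eigen_neg_iff]
    decide
  · rw [card_filter_eq_of_map_eq hm (· = 0)]
    simp only [eigen_eq_zero_iff]
    decide

end

end AllcockStmt8
end

section
/- The 16 × 16 Hermitian Gram matrix G(Y_555) has rank 14 and, counted with multiplicity, exactly 13 of its (necessarily real) eigenvalues are positive, exactly 1 is negative, and exactly 2 are zero. (The Hermitian form on the Eisenstein lattice L(Y_555) has a two-dimensional kernel whose quotient is the rank 14 Lorentzian Allcock lattice L(Y_544).) -/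
namespace AllcockStmt9

noncomputable section

/-- `θ = i√3`. -/
def θ : ℂ := Complex.I * Real.sqrt 3

/-- Vertices of the Coxeter diagram `Y_555`: a central vertex together with
three arms of length `5`; vertex `(k, j)` is the `(j+1)`-st vertex of arm `k`. -/
abbrev V555 := Unit ⊕ (Fin 3 × Fin 5)

/-- The Gram matrix `G(Y_555)`: diagonal entries `3`; for each edge `{u, v}`
with `u` nearer to the central vertex, entry `θ` in position `(u, v)` and
`-θ` in position `(v, u)`; all other entries `0`.  The edges join the center
to the first vertex of each arm, and consecutive vertices of each arm. -/
def G555 : Matrix V555 V555 ℂ := fun u v =>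
  match u, v with
  | Sum.inl _, Sum.inl _ => 3
  | Sum.inl _, Sum.inr (_, j) => if (j : ℕ) = 0 then θ else 0
  | Sum.inr (_, j), Sum.inl _ => if (j : ℕ) = 0 then -θ else 0
  | Sum.inr (k, j), Sum.inr (k', j') =>
      if k = k' then
        (if j = j' then 3
         else if (j : ℕ) + 1 = (j' : ℕ) then θ
         else if (j' : ℕ) + 1 = (j : ℕ) then -θ
         else 0)
      else 0

open Matrix in
/-- The Hermitian form of `A` in the coordinates given by an eigenvector basis. -/
lemma hermitianForm_eq_sum_eigenvalues {n : Type*} [Fintype n] [DecidableEq n]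
    {A : Matrix n n ℂ} (hA : A.IsHermitian) (x : n → ℂ) :
    star x ⬝ᵥ A *ᵥ x = ((∑ i, hA.eigenvalues i *
      Complex.normSq ((star (hA.eigenvectorUnitary : Matrix n n ℂ) *ᵥ x) i) : ℝ) : ℂ) := by
  have h := hA.spectral_theorem
  rw [Unitary.conjStarAlgAut_apply] at h
  set U : Matrix n n ℂ := hA.eigenvectorUnitary.1
  conv_lhs => rw [h]
  rw [← mulVec_mulVec, ← mulVec_mulVec, dotProduct_mulVec,
    show star x ᵥ* U = star (star U *ᵥ x) by
      rw [star_mulVec, star_eq_conjTranspose, conjTranspose_conjTranspose]]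
  simp only [dotProduct, mulVec_diagonal, Complex.ofReal_sum, Complex.ofReal_mul,
    Complex.normSq_eq_conj_mul_self, Pi.star_apply, Function.comp_apply]
  refine Finset.sum_congr rfl fun i _ => ?_
  simp only [RCLike.star_def, Complex.coe_algebraMap]
  ring

open Matrix in
/-- If the Hermitian form of `A` is positive definite on the kernel of a linear map to `m → ℂ`,
then at most `card m` eigenvalues of `A` are not positive. -/
lemma card_le_card_add_card_pos_eigenvalues {n m : Type*} [Fintype n] [DecidableEq n] [Fintype m]
    {A : Matrix n n ℂ} (hA : A.IsHermitian) (L : (n → ℂ) →ₗ[ℂ] (m → ℂ))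
    (hL : ∀ x, L x = 0 → (star x ⬝ᵥ A *ᵥ x).re ≤ 0 → x = 0) :
    Fintype.card n ≤
      Fintype.card m + (Finset.univ.filter fun i => 0 < hA.eigenvalues i).card := by
  let P : (n → ℂ) →ₗ[ℂ] ({i // 0 < hA.eigenvalues i} → ℂ) :=
    (LinearMap.funLeft ℂ ℂ Subtype.val).comp
      (mulVecLin (star (hA.eigenvectorUnitary : Matrix n n ℂ)))
  have hinj : Function.Injective (L.prod P) := by
    rw [injective_iff_map_eq_zero]
    intro x hx
    obtain ⟨hx₁, hx₂⟩ := Prod.ext_iff.1 hx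
    refine hL x hx₁ ?_
    rw [hermitianForm_eq_sum_eigenvalues hA, Complex.ofReal_re]
    refine Finset.sum_nonpos fun i _ => ?_
    by_cases hi : 0 < hA.eigenvalues i
    · have h0 : (star (hA.eigenvectorUnitary : Matrix n n ℂ) *ᵥ x) i = 0 := congrFun hx₂ ⟨i, hi⟩
      simp [h0]
    · exact mul_nonpos_of_nonpos_of_nonneg (not_lt.1 hi) (Complex.normSq_nonneg _)
  have h := LinearMap.finrank_le_finrank_of_injective hinj
  rwa [Module.finrank_prod, Module.finrank_fintype_fun_eq_card, Module.finrank_fintype_fun_eq_card,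
    Module.finrank_fintype_fun_eq_card, Fintype.card_subtype] at h

open Matrix in
/-- A Hermitian matrix whose form takes a negative value has a negative eigenvalue. -/
lemma exists_eigenvalue_neg {n : Type*} [Fintype n] [DecidableEq n]
    {A : Matrix n n ℂ} (hA : A.IsHermitian) {x : n → ℂ} (hx : (star x ⬝ᵥ A *ᵥ x).re < 0) :
    ∃ i, hA.eigenvalues i < 0 := by
  by_contra! h
  rw [hermitianForm_eq_sum_eigenvalues hA, Complex.ofReal_re] at hx
  exact hx.not_ge (Finset.sum_nonneg fun i _ => mul_nonneg (h i) (Complex.normSq_nonneg _))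

lemma θ_mul_self : θ * θ = -3 := by
  have h : (Real.sqrt 3 : ℂ) * Real.sqrt 3 = 3 := by
    rw [← Complex.ofReal_mul, Real.mul_self_sqrt (by norm_num)]
    norm_num
  unfold θ
  linear_combination Complex.I * Complex.I * h + 3 * Complex.I_mul_I

lemma star_θ : star θ = -θ := by
  simp [θ]

lemma G555_isHermitian : G555.IsHermitian := by
  ext u v
  rw [Matrix.conjTranspose_apply]
  rcases u with u | ⟨k, j⟩ <;> rcases v with v | ⟨k', j'⟩
  · simp [G555]
  · by_cases h : (j' : ℕ) = 0 <;> simp only [G555, h, if_true, if_false, star_neg, star_θ,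
      neg_neg, star_zero]
  · by_cases h : (j : ℕ) = 0 <;> simp only [G555, h, if_true, if_false, star_θ, star_zero]
  · simp only [G555, eq_comm (a := k'), eq_comm (a := j')]
    split_ifs <;> first | omega | simp [star_θ]

/-- The image of a vector under `G555`, at the central vertex. -/
lemma G555_mulVec_inl (x : V555 → ℂ) (u : Unit) :
    (G555.mulVec x) (Sum.inl u) = 3 * x (Sum.inl ()) + θ * ∑ k, x (Sum.inr (k, 0)) := by
  simp [Matrix.mulVec, dotProduct, G555, Fintype.sum_prod_type, Fin.sum_univ_succ]
  ring

/-- The image of a vector under `G555`, along the arm `k`. -/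
lemma G555_mulVec_inr (x : V555 → ℂ) (k : Fin 3) (j : Fin 5) :
    (G555.mulVec x) (Sum.inr (k, j)) =
      ![-θ * x (Sum.inl ()) + 3 * x (Sum.inr (k, 0)) + θ * x (Sum.inr (k, 1)),
        -θ * x (Sum.inr (k, 0)) + 3 * x (Sum.inr (k, 1)) + θ * x (Sum.inr (k, 2)),
        -θ * x (Sum.inr (k, 1)) + 3 * x (Sum.inr (k, 2)) + θ * x (Sum.inr (k, 3)),
        -θ * x (Sum.inr (k, 2)) + 3 * x (Sum.inr (k, 3)) + θ * x (Sum.inr (k, 4)),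
        -θ * x (Sum.inr (k, 3)) + 3 * x (Sum.inr (k, 4))] j := by
  fin_cases k <;> fin_cases j <;>
    simp [Matrix.mulVec, dotProduct, G555, Fintype.sum_prod_type, Fin.sum_univ_succ] <;> ring

open Matrix in
/-- On the vectors vanishing next to the centre, the form of `G555` is a sum of squares. -/
lemma G555_form_of_eq_zero (x : V555 → ℂ) (hx : ∀ k, x (Sum.inr (k, 0)) = 0) :
    star x ⬝ᵥ G555 *ᵥ x = ((3 * Complex.normSq (x (Sum.inl ())) +
      ∑ k : Fin 3, (Complex.normSq (x (Sum.inr (k, 1))) +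
        3 / 2 * Complex.normSq (x (Sum.inr (k, 2)) - 2 / 3 * θ * x (Sum.inr (k, 1))) +
        2 * Complex.normSq (x (Sum.inr (k, 3)) - θ / 2 * x (Sum.inr (k, 2))) +
        3 * Complex.normSq (x (Sum.inr (k, 4)) - θ / 3 * x (Sum.inr (k, 3)))) : ℝ) : ℂ) := by
  have hθ : (starRingEnd ℂ) θ = -θ := star_θ
  simp only [dotProduct, Fintype.sum_sum_type, Fintype.sum_prod_type, Finset.univ_unique,
    Finset.sum_singleton, G555_mulVec_inl, G555_mulVec_inr]
  push_cast
  refine congrArg₂ _ ?_ (Finset.sum_congr rfl fun k _ => ?_)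
  · simp only [hx, Pi.star_apply, RCLike.star_def, Complex.normSq_eq_conj_mul_self,
      Finset.sum_const_zero, PUnit.default_eq_unit]
    ring
  · simp only [Fin.sum_univ_five, hx, Pi.star_apply, RCLike.star_def,
      Complex.normSq_eq_conj_mul_self, map_sub, map_mul, map_div₀, hθ, map_ofNat, map_zero,
      Matrix.cons_val]
    linear_combination (2 / 3 * (starRingEnd ℂ) (x (Sum.inr (k, 1))) * x (Sum.inr (k, 1)) +
      1 / 2 * (starRingEnd ℂ) (x (Sum.inr (k, 2))) * x (Sum.inr (k, 2)) +
      1 / 3 * (starRingEnd ℂ) (x (Sum.inr (k, 3))) * x (Sum.inr (k, 3))) * θ_mul_self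

/-- At most three eigenvalues of `G555` are not positive. -/
lemma thirteen_le_card_pos_eigenvalues :
    13 ≤ (Finset.univ.filter fun i => 0 < G555_isHermitian.eigenvalues i).card := by
  have h := card_le_card_add_card_pos_eigenvalues G555_isHermitian
    (LinearMap.funLeft ℂ ℂ fun k : Fin 3 => (Sum.inr (k, 0) : V555)) ?_
  · have hcard : Fintype.card V555 = 16 := by simp
    rw [hcard, Fintype.card_fin] at h
    omega
  intro x hx hle
  have h0 : ∀ k, x (Sum.inr (k, 0)) = 0 := fun k => congrFun hx k
  rw [G555_form_of_eq_zero x h0, Complex.ofReal_re] at hle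
  have hnn (z : ℂ) : 0 ≤ Complex.normSq z := Complex.normSq_nonneg z
  have hterm : ∀ k ∈ Finset.univ, 0 ≤ Complex.normSq (x (Sum.inr (k, 1))) +
        3 / 2 * Complex.normSq (x (Sum.inr (k, 2)) - 2 / 3 * θ * x (Sum.inr (k, 1))) +
        2 * Complex.normSq (x (Sum.inr (k, 3)) - θ / 2 * x (Sum.inr (k, 2))) +
        3 * Complex.normSq (x (Sum.inr (k, 4)) - θ / 3 * x (Sum.inr (k, 3))) := by
    intro k _
    have := hnn (x (Sum.inr (k, 2)) - 2 / 3 * θ * x (Sum.inr (k, 1)))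
    have := hnn (x (Sum.inr (k, 1)))
    have := hnn (x (Sum.inr (k, 3)) - θ / 2 * x (Sum.inr (k, 2)))
    have := hnn (x (Sum.inr (k, 4)) - θ / 3 * x (Sum.inr (k, 3)))
    positivity
  have hz := hnn (x (Sum.inl ()))
  have hsum := Finset.sum_nonneg hterm
  have hcentre : x (Sum.inl ()) = 0 := Complex.normSq_eq_zero.1 (by linarith)
  have harm := (Finset.sum_eq_zero_iff_of_nonneg hterm).1 (by linarith)
  ext v
  rcases v with v | ⟨k, j⟩
  · exact hcentre
  have hk := harm k (Finset.mem_univ k)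
  have n1 := hnn (x (Sum.inr (k, 1)))
  have n2 := hnn (x (Sum.inr (k, 2)) - 2 / 3 * θ * x (Sum.inr (k, 1)))
  have n3 := hnn (x (Sum.inr (k, 3)) - θ / 2 * x (Sum.inr (k, 2)))
  have n4 := hnn (x (Sum.inr (k, 4)) - θ / 3 * x (Sum.inr (k, 3)))
  have h1 : x (Sum.inr (k, 1)) = 0 := Complex.normSq_eq_zero.1 (by linarith)
  have h2 : x (Sum.inr (k, 2)) = 0 := by
    have := Complex.normSq_eq_zero.1 (le_antisymm (by linarith) n2)
    simpa [h1] using this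
  have h3 : x (Sum.inr (k, 3)) = 0 := by
    have := Complex.normSq_eq_zero.1 (le_antisymm (by linarith) n3)
    simpa [h2] using this
  have h4 : x (Sum.inr (k, 4)) = 0 := by
    have := Complex.normSq_eq_zero.1 (le_antisymm (by linarith) n4)
    simpa [h3] using this
  fin_cases j
  exacts [h0 k, h1, h2, h3, h4]

/-- The null vector of an arm of length five, placed on each arm with the given coefficient,
together with a prescribed value at the centre. -/
def armVector (z : ℂ) (c : Fin 3 → ℂ) : V555 → ℂ :=
  Sum.elim (fun _ => z) fun kj => c kj.1 * ![1, θ, -2, -θ, 1] kj.2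

lemma G555_mulVec_armVector (z : ℂ) (c : Fin 3 → ℂ) :
    G555.mulVec (armVector z c) =
      Sum.elim (fun _ => 3 * z + θ * ∑ k, c k) fun kj => if kj.2 = 0 then -θ * z else 0 := by
  ext v
  rcases v with v | ⟨k, j⟩
  · simp [G555_mulVec_inl, armVector]
  · rw [G555_mulVec_inr]
    fin_cases j <;> simp [armVector]
    · linear_combination c k * θ_mul_self
    · ring
    · linear_combination -2 * c k * θ_mul_self
    · ring
    · linear_combination c k * θ_mul_self

lemma exists_eigenvalue_G555_neg : ∃ i, G555_isHermitian.eigenvalues i < 0 := by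
  refine exists_eigenvalue_neg G555_isHermitian (x := armVector 1 fun _ => θ) ?_
  have h : star (armVector 1 fun _ => θ) ⬝ᵥ G555.mulVec (armVector 1 fun _ => θ) = -15 := by
    have hθ : (starRingEnd ℂ) θ = -θ := star_θ
    rw [G555_mulVec_armVector]
    simp [dotProduct, Fintype.sum_prod_type, armVector, hθ]
    linear_combination 6 * θ_mul_self
  rw [h]
  norm_num

lemma G555_rank_le : G555.rank ≤ 14 := by
  let c : Fin 2 → Fin 3 → ℂ := ![![1, -1, 0], ![0, 1, -1]]
  have hker (i : Fin 2) : armVector 0 (c i) ∈ LinearMap.ker G555.mulVecLin := by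
    rw [LinearMap.mem_ker, Matrix.mulVecLin_apply, G555_mulVec_armVector]
    ext v
    fin_cases i <;> rcases v with v | v <;> simp [c, Fin.sum_univ_three]
  have hli : LinearIndependent ℂ
      fun i => (⟨armVector 0 (c i), hker i⟩ : LinearMap.ker G555.mulVecLin) := by
    refine LinearIndependent.of_comp (LinearMap.ker G555.mulVecLin).subtype ?_
    rw [Fintype.linearIndependent_iff]
    intro g hg
    have h0 := congrFun hg (Sum.inr (0, 0))
    have h2 := congrFun hg (Sum.inr (2, 0))
    simp [c, armVector] at h0 h2
    intro i
    fin_cases i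
    exacts [h0, h2]
  have h := hli.fintype_card_le_finrank
  have hrn := LinearMap.finrank_range_add_finrank_ker G555.mulVecLin
  rw [Module.finrank_fintype_fun_eq_card] at hrn
  have hcard : Fintype.card V555 = 16 := by simp
  rw [Fintype.card_fin] at h
  rw [Matrix.rank]
  omega

/-- The `16 × 16` Hermitian Gram matrix `G(Y_555)` has rank `14`
and, counted with multiplicity, exactly `13` of its (necessarily real)
eigenvalues are positive, exactly `1` is negative, and exactly `2` are zero. -/
theorem G555_rank_and_signature :
    ∃ hH : G555.IsHermitian,
      G555.rank = 14 ∧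
      (Finset.univ.filter fun i => 0 < hH.eigenvalues i).card = 13 ∧
      (Finset.univ.filter fun i => hH.eigenvalues i < 0).card = 1 ∧
      (Finset.univ.filter fun i => hH.eigenvalues i = 0).card = 2 := by
  refine ⟨G555_isHermitian, ?_⟩
  have hpos := thirteen_le_card_pos_eigenvalues
  have hrank_le := G555_rank_le
  have hrank := G555_isHermitian.rank_eq_card_non_zero_eigs
  rw [Fintype.card_subtype] at hrank
  have hneg : 1 ≤ (Finset.univ.filter fun i => G555_isHermitian.eigenvalues i < 0).card := by
    obtain ⟨i, hi⟩ := exists_eigenvalue_G555_neg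
    exact Finset.card_pos.2 ⟨i, by simpa using hi⟩
  have hne : (Finset.univ.filter fun i => G555_isHermitian.eigenvalues i ≠ 0).card =
      (Finset.univ.filter fun i => 0 < G555_isHermitian.eigenvalues i).card +
      (Finset.univ.filter fun i => G555_isHermitian.eigenvalues i < 0).card := by
    rw [← Finset.card_union_of_disjoint]
    · congr 1
      ext i
      simp only [Finset.mem_union, Finset.mem_filter_univ, ne_iff_lt_or_gt, or_comm]
    · exact Finset.disjoint_filter.2 fun i _ h => h.not_gt
  have htotal := Finset.card_filter_add_card_filter_not (s := (Finset.univ : Finset V555))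
    (fun i => G555_isHermitian.eigenvalues i = 0)
  have hcard : (Finset.univ : Finset V555).card = 16 := by simp
  rw [hcard] at htotal
  simp only [ne_eq] at hrank hne
  refine ⟨?_, ?_, ?_, ?_⟩ <;> omega

end

end AllcockStmt9
end

section
/- The 14 × 14 Hermitian Gram matrix G(Y_544) is invertible and, counted with multiplicity, exactly 13 of its (necessarily real) eigenvalues are positive and exactly 1 is negative. (The Allcock lattice L = L(Y_544) is a Lorentzian Eisenstein lattice of rank 14.) -/
namespace AllcockStmt10

noncomputable section

/-- `θ = i√3`. -/
def θ : ℂ := Complex.I * Real.sqrt 3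

/-- Vertices of the Coxeter diagram `Y_544`: a central vertex together with
one arm of length `5` and two arms of length `4`. -/
abbrev V544 := Unit ⊕ (Fin 5 ⊕ (Fin 4 ⊕ Fin 4))

/-- The arm coordinates `(k, j)` of a non-central vertex:
`k ∈ {0, 1, 2}` is the arm and `j` the position along the arm (`j = 0` for the
vertex adjacent to the center). -/
def arm : V544 → Option (Fin 3 × ℕ)
  | Sum.inl _ => none
  | Sum.inr (Sum.inl j) => some (0, (j : ℕ))
  | Sum.inr (Sum.inr (Sum.inl j)) => some (1, (j : ℕ))
  | Sum.inr (Sum.inr (Sum.inr j)) => some (2, (j : ℕ))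

/-- The Gram matrix `G(Y_544)`: diagonal entries `3`; for each edge `{u, v}`
with `u` nearer to the central vertex, entry `θ` in position `(u, v)` and
`-θ` in position `(v, u)`; all other entries `0`. -/
def G544 : Matrix V544 V544 ℂ := fun u v =>
  match arm u, arm v with
  | none, none => 3
  | none, some (_, j) => if j = 0 then θ else 0
  | some (_, j), none => if j = 0 then -θ else 0
  | some (k, j), some (k', j') =>
      if k = k' then
        (if j = j' then 3
         else if j + 1 = j' then θ
         else if j' + 1 = j then -θ
         else 0)
      else 0

section Inertia

open Matrix
open scoped ComplexOrder

variable {n : Type*} [Fintype n] [DecidableEq n] {A : Matrix n n ℂ}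

/-- A Hermitian form that is positive on the nonzero vectors of the kernel of a linear functional
has at most one nonpositive eigenvalue. -/
theorem eigenvalues_nonpos_unique (hA : A.IsHermitian) (f : (n → ℂ) →ₗ[ℂ] ℂ)
    (hf : ∀ x, f x = 0 → x ≠ 0 → 0 < star x ⬝ᵥ A *ᵥ x) {i j : n}
    (hi : hA.eigenvalues i ≤ 0) (hj : hA.eigenvalues j ≤ 0) : i = j := by
  by_contra hij
  set u : n → n → ℂ := fun k => ⇑(hA.eigenvectorBasis k) with hu
  have horth : ∀ k l, star (u k) ⬝ᵥ u l = if k = l then 1 else 0 := by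
    intro k l
    have h := orthonormal_iff_ite.mp hA.eigenvectorBasis.orthonormal k l
    rw [EuclideanSpace.inner_eq_star_dotProduct, dotProduct_comm] at h
    exact h
  obtain ⟨a, b, hab, hzero⟩ : ∃ a b : ℂ, (a ≠ 0 ∨ b ≠ 0) ∧ a * f (u i) + b * f (u j) = 0 := by
    by_cases h : f (u i) = 0
    · exact ⟨1, 0, by simp, by simp [h]⟩
    · exact ⟨-f (u j), f (u i), Or.inr h, by ring⟩
  have hstar : star (a • u i + b • u j) = star a • star (u i) + star b • star (u j) := by
    simp
  have hpos := hf (a • u i + b • u j) (by simpa using hzero) (by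
    intro h0
    have h1 : star (u i) ⬝ᵥ (a • u i + b • u j) = a := by
      simp [dotProduct_add, dotProduct_smul, horth, hij]
    have h2 : star (u j) ⬝ᵥ (a • u i + b • u j) = b := by
      simp [dotProduct_add, dotProduct_smul, horth, Ne.symm hij]
    rw [h0, dotProduct_zero] at h1 h2
    rcases hab with h | h
    · exact h h1.symm
    · exact h h2.symm)
  have hmul : ∀ k, A *ᵥ u k = hA.eigenvalues k • u k := hA.mulVec_eigenvectorBasis
  have hval : star (a • u i + b • u j) ⬝ᵥ A *ᵥ (a • u i + b • u j) =
      ((hA.eigenvalues i * Complex.normSq a + hA.eigenvalues j * Complex.normSq b : ℝ) : ℂ) := by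
    rw [hstar, mulVec_add, mulVec_smul, mulVec_smul, hmul, hmul]
    simp only [add_dotProduct, dotProduct_add, smul_dotProduct, dotProduct_smul, horth, hij,
      Ne.symm hij, if_true, if_false]
    simp only [smul_eq_mul, Complex.real_smul, mul_zero, mul_one, add_zero, zero_add,
      Complex.ofReal_add, Complex.ofReal_mul, Complex.normSq_eq_conj_mul_self, Complex.star_def]
    ring
  rw [hval] at hpos
  have hpos' := Complex.zero_lt_real.mp hpos
  nlinarith [mul_nonneg (neg_nonneg.mpr hi) (Complex.normSq_nonneg a),
    mul_nonneg (neg_nonneg.mpr hj) (Complex.normSq_nonneg b)]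

/-- A Hermitian form that takes a negative value has a negative eigenvalue. -/
theorem exists_eigenvalues_neg (hA : A.IsHermitian) {v : n → ℂ} (hv : star v ⬝ᵥ A *ᵥ v < 0) :
    ∃ i, hA.eigenvalues i < 0 := by
  by_contra! h
  exact (hA.posSemidef_iff_eigenvalues_nonneg.mpr h).dotProduct_mulVec_nonneg v |>.not_gt hv

/-- A Hermitian form that takes a negative value and is positive on the nonzero vectors of the
kernel of a linear functional is nondegenerate, with exactly one negative eigenvalue. -/
theorem lorentzian_of_pos_on_ker (hA : A.IsHermitian) (f : (n → ℂ) →ₗ[ℂ] ℂ)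
    (hf : ∀ x, f x = 0 → x ≠ 0 → 0 < star x ⬝ᵥ A *ᵥ x) {v : n → ℂ}
    (hv : star v ⬝ᵥ A *ᵥ v < 0) :
    IsUnit A.det ∧
      (Finset.univ.filter fun i => 0 < hA.eigenvalues i).card = Fintype.card n - 1 ∧
      (Finset.univ.filter fun i => hA.eigenvalues i < 0).card = 1 := by
  obtain ⟨k, hk⟩ := exists_eigenvalues_neg hA hv
  have hpos : ∀ i, i ≠ k → 0 < hA.eigenvalues i := fun i hi => by
    by_contra! h
    exact hi (eigenvalues_nonpos_unique hA f hf h hk.le)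
  refine ⟨?_, ?_, ?_⟩
  · rw [isUnit_iff_ne_zero, hA.det_eq_prod_eigenvalues, Finset.prod_ne_zero_iff]
    intro i _
    rw [ne_eq, RCLike.ofReal_eq_zero]
    by_cases hi : i = k
    · exact hi ▸ hk.ne
    · exact (hpos i hi).ne'
  · have : (Finset.univ.filter fun i => 0 < hA.eigenvalues i) = Finset.univ.erase k := by
      ext i
      simp only [Finset.mem_filter, Finset.mem_univ, true_and, Finset.mem_erase, and_true]
      exact ⟨fun h hi => (hi ▸ h).not_gt hk, hpos i⟩
    rw [this, Finset.card_erase_of_mem (Finset.mem_univ k), Finset.card_univ]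
  · rw [Finset.card_eq_one]
    refine ⟨k, ?_⟩
    ext i
    simp only [Finset.mem_filter, Finset.mem_univ, true_and, Finset.mem_singleton]
    exact ⟨fun h => by_contra fun hi => (hpos i hi).not_gt h, fun h => h ▸ hk⟩

end Inertia

theorem θ_mul_self : θ * θ = -3 := by
  have h : ((Real.sqrt 3 : ℝ) : ℂ) * (Real.sqrt 3 : ℝ) = 3 := by
    rw [← Complex.ofReal_mul, Real.mul_self_sqrt (by norm_num)]
    norm_num
  unfold θ
  linear_combination (Complex.I * Complex.I) * h + 3 * Complex.I_mul_I

theorem star_θ : star θ = -θ := by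
  simp [θ]

theorem G544_isHermitian : G544.IsHermitian := by
  ext u v
  rw [Matrix.conjTranspose_apply]
  rcases u with _ | i | i | i <;> rcases v with _ | j | j | j <;>
    simp only [G544, arm] <;> (try fin_cases i) <;> (try fin_cases j) <;> simp [star_θ]

open Matrix in
/-- The Gaussian decomposition of the form `G544`, eliminating from the ends of the arms. -/
theorem G544_form (x : V544 → ℂ) :
    star x ⬝ᵥ G544 *ᵥ x =
      let z := x (Sum.inl ())
      let a := fun j => x (Sum.inr (Sum.inl j))
      let b := fun j => x (Sum.inr (Sum.inr (Sum.inl j)))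
      let c := fun j => x (Sum.inr (Sum.inr (Sum.inr j)))
      ((3 * Complex.normSq (a 4 - θ / 3 * a 3) + 2 * Complex.normSq (a 3 - θ / 2 * a 2)
        + 3 / 2 * Complex.normSq (a 2 - 2 * θ / 3 * a 1) + Complex.normSq (a 1 - θ * a 0)
        + 3 * Complex.normSq (b 3 - θ / 3 * b 2) + 2 * Complex.normSq (b 2 - θ / 2 * b 1)
        + 3 / 2 * Complex.normSq (b 1 - 2 * θ / 3 * b 0) + Complex.normSq (b 0 - θ * z)
        + 3 * Complex.normSq (c 3 - θ / 3 * c 2) + 2 * Complex.normSq (c 2 - θ / 2 * c 1)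
        + 3 / 2 * Complex.normSq (c 1 - 2 * θ / 3 * c 0) + Complex.normSq (c 0 - θ * z)
        + Complex.normSq (a 0) - 3 * Complex.normSq (z - θ / 3 * a 0) : ℝ) : ℂ) := by
  have hθ : (starRingEnd ℂ) θ = -θ := star_θ
  have hconj2 : (starRingEnd ℂ) 2 = 2 := Complex.conj_ofNat 2
  have hconj3 : (starRingEnd ℂ) 3 = 3 := Complex.conj_ofNat 3
  have hsq : θ ^ 2 = -3 := by rw [sq, θ_mul_self]
  simp only [dotProduct, mulVec, Fintype.sum_sum_type, Fin.sum_univ_five, Fin.sum_univ_four,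
    Finset.univ_unique, Finset.sum_singleton, G544, arm]
  simp [Complex.normSq_eq_conj_mul_self, hθ, hconj2, hconj3]
  ring_nf
  simp only [hsq]
  ring

open Matrix ComplexOrder in
theorem G544_form_pos (x : V544 → ℂ)
    (hx : x (Sum.inl ()) - θ / 3 * x (Sum.inr (Sum.inl 0)) = 0) (hx0 : x ≠ 0) :
    0 < star x ⬝ᵥ G544 *ᵥ x := by
  rw [G544_form]
  refine Complex.zero_lt_real.mpr ?_
  rw [hx, Complex.normSq_zero]
  by_contra! hle
  refine hx0 ?_
  set z := x (Sum.inl ()) with hz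
  set a := fun j => x (Sum.inr (Sum.inl j)) with ha
  set b := fun j => x (Sum.inr (Sum.inr (Sum.inl j))) with hb
  set c := fun j => x (Sum.inr (Sum.inr (Sum.inr j))) with hc
  have h1 := Complex.normSq_nonneg (a 4 - θ / 3 * a 3)
  have h2 := Complex.normSq_nonneg (a 3 - θ / 2 * a 2)
  have h3 := Complex.normSq_nonneg (a 2 - 2 * θ / 3 * a 1)
  have h4 := Complex.normSq_nonneg (a 1 - θ * a 0)
  have h5 := Complex.normSq_nonneg (b 3 - θ / 3 * b 2)
  have h6 := Complex.normSq_nonneg (b 2 - θ / 2 * b 1)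
  have h7 := Complex.normSq_nonneg (b 1 - 2 * θ / 3 * b 0)
  have h8 := Complex.normSq_nonneg (b 0 - θ * z)
  have h9 := Complex.normSq_nonneg (c 3 - θ / 3 * c 2)
  have h10 := Complex.normSq_nonneg (c 2 - θ / 2 * c 1)
  have h11 := Complex.normSq_nonneg (c 1 - 2 * θ / 3 * c 0)
  have h12 := Complex.normSq_nonneg (c 0 - θ * z)
  have h13 := Complex.normSq_nonneg (a 0)
  have a0 : a 0 = 0 := Complex.normSq_eq_zero.mp (by linarith)
  have a1 : a 1 - θ * a 0 = 0 := Complex.normSq_eq_zero.mp (by linarith)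
  have a2 : a 2 - 2 * θ / 3 * a 1 = 0 := Complex.normSq_eq_zero.mp (by linarith)
  have a3 : a 3 - θ / 2 * a 2 = 0 := Complex.normSq_eq_zero.mp (by linarith)
  have a4 : a 4 - θ / 3 * a 3 = 0 := Complex.normSq_eq_zero.mp (by linarith)
  have b0 : b 0 - θ * z = 0 := Complex.normSq_eq_zero.mp (by linarith)
  have b1 : b 1 - 2 * θ / 3 * b 0 = 0 := Complex.normSq_eq_zero.mp (by linarith)
  have b2 : b 2 - θ / 2 * b 1 = 0 := Complex.normSq_eq_zero.mp (by linarith)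
  have b3 : b 3 - θ / 3 * b 2 = 0 := Complex.normSq_eq_zero.mp (by linarith)
  have c0 : c 0 - θ * z = 0 := Complex.normSq_eq_zero.mp (by linarith)
  have c1 : c 1 - 2 * θ / 3 * c 0 = 0 := Complex.normSq_eq_zero.mp (by linarith)
  have c2 : c 2 - θ / 2 * c 1 = 0 := Complex.normSq_eq_zero.mp (by linarith)
  have c3 : c 3 - θ / 3 * c 2 = 0 := Complex.normSq_eq_zero.mp (by linarith)
  have z0 : z - θ / 3 * a 0 = 0 := hx
  simp only [a0, mul_zero, sub_zero] at a1 z0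
  simp only [a1, mul_zero, sub_zero] at a2
  simp only [a2, mul_zero, sub_zero] at a3
  simp only [a3, mul_zero, sub_zero] at a4
  simp only [z0, mul_zero, sub_zero] at b0 c0
  simp only [b0, mul_zero, sub_zero] at b1
  simp only [b1, mul_zero, sub_zero] at b2
  simp only [b2, mul_zero, sub_zero] at b3
  simp only [c0, mul_zero, sub_zero] at c1
  simp only [c1, mul_zero, sub_zero] at c2
  simp only [c2, mul_zero, sub_zero] at c3
  funext i
  rcases i with _ | i | i | i
  · exact z0
  all_goals fin_cases i <;> assumption

open Matrix ComplexOrder in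
/-- The form `G544` takes the value `-3` on the vector with central coordinate `1` that is
orthogonal to all roots of the two arms of length `4` and vanishes on the third arm. -/
theorem exists_G544_form_neg : ∃ v : V544 → ℂ, star v ⬝ᵥ G544 *ᵥ v < 0 := by
  refine ⟨Sum.elim (fun _ => 1) (Sum.elim 0 (Sum.elim ![θ, -2, -θ, 1] ![θ, -2, -θ, 1])), ?_⟩
  have h1 : -2 - 2 * θ / 3 * θ = 0 := by linear_combination (-2 / 3) * θ_mul_self
  have h2 : 1 - θ / 3 * -θ = 0 := by linear_combination (1 / 3) * θ_mul_self
  have h3 : -θ - θ / 2 * -2 = 0 := by ring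
  rw [G544_form, ← Complex.ofReal_zero]
  refine Complex.real_lt_real.mpr ?_
  simp only [Sum.elim_inl, Sum.elim_inr, Pi.zero_apply, Matrix.cons_val, h1, h2, h3]
  norm_num

/-- The `14 × 14` Hermitian Gram matrix `G(Y_544)` is invertible
and, counted with multiplicity, exactly `13` of its (necessarily real)
eigenvalues are positive and exactly `1` is negative.  (The Allcock lattice
`L = L(Y_544)` is a Lorentzian Eisenstein lattice of rank `14`.) -/
theorem G544_lorentzian :
    ∃ hH : G544.IsHermitian,
      IsUnit G544.det ∧
      (Finset.univ.filter fun i => 0 < hH.eigenvalues i).card = 13 ∧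
      (Finset.univ.filter fun i => hH.eigenvalues i < 0).card = 1 := by
  obtain ⟨v, hv⟩ := exists_G544_form_neg
  refine ⟨G544_isHermitian, lorentzian_of_pos_on_ker G544_isHermitian
    (LinearMap.proj (Sum.inl ()) - (θ / 3) • LinearMap.proj (Sum.inr (Sum.inl 0)))
    (fun x hx hx0 => G544_form_pos x (by simpa using hx) hx0)
    hv⟩

end

end AllcockStmt10
end

section
/- The 26 × 26 Hermitian matrix G(I_26) has rank 14 and, counted with multiplicity, exactly 13 of its (necessarily real) eigenvalues are positive, exactly 1 is negative, and exactly 12 are zero. (Basak's theorem: the Hermitian form of the Eisenstein lattice L(I_26) has a kernel of dimension 12 and the quotient of L(I_26) by this kernel is the rank 14 Lorentzian Allcock lattice L.) -/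
open scoped Classical

namespace AllcockStmt11

noncomputable section

/-- `θ = i√3`. -/
def θ : ℂ := Complex.I * Real.sqrt 3

/-- The points of the projective plane `ℙ²(𝔽₃)`: the one-dimensional linear
subspaces of `𝔽₃³`. -/
abbrev Pt := {W : Submodule (ZMod 3) (Fin 3 → ZMod 3) // Module.finrank (ZMod 3) W = 1}

/-- The lines of the projective plane `ℙ²(𝔽₃)`: the two-dimensional linear
subspaces of `𝔽₃³`. -/
abbrev Ln := {W : Submodule (ZMod 3) (Fin 3 → ZMod 3) // Module.finrank (ZMod 3) W = 2}

instance : DecidableEq Pt := Classical.decEq _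
instance : DecidableEq Ln := Classical.decEq _

/-- The Gram matrix `G(I_26)` of the incidence diagram of `ℙ²(𝔽₃)`, indexed by
the `26` nodes `P ⊔ L`: diagonal entries `3`, entry `θ` in position `(p, l)`
and `-θ` in position `(l, p)` for every incident pair (`p ⊆ l`), all other
entries `0`. -/
def G : Matrix (Pt ⊕ Ln) (Pt ⊕ Ln) ℂ := fun u v =>
  match u, v with
  | Sum.inl p, Sum.inl q => if p = q then 3 else 0
  | Sum.inl p, Sum.inr l => if p.1 ≤ l.1 then θ else 0
  | Sum.inr l, Sum.inl p => if p.1 ≤ l.1 then -θ else 0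
  | Sum.inr l, Sum.inr m => if l = m then 3 else 0

open Module Polynomial

theorem card_finrank_eq_one {K V : Type*} [Field K] [Finite K] [AddCommGroup V] [Module K V]
    {n : ℕ} (h : finrank K V = n) :
    Nat.card {W : Submodule K V // finrank K W = 1} = ∑ i ∈ Finset.range n, Nat.card K ^ i := by
  rw [← Projectivization.card_of_finrank K V h]
  exact Nat.card_congr (Projectivization.equivSubmodule K V).symm

/-- Hyperplanes of `V` correspond to points of the dual projective space. -/
theorem card_finrank_add_one_eq {K V : Type*} [Field K] [Finite K] [AddCommGroup V] [Module K V]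
    [FiniteDimensional K V] {n : ℕ} (h : finrank K V = n + 1) :
    Nat.card {W : Submodule K V // finrank K W = n} =
      ∑ i ∈ Finset.range (n + 1), Nat.card K ^ i := by
  rw [← card_finrank_eq_one (K := K) (V := Dual K V) (by rw [Subspace.dual_finrank_eq, h])]
  refine Nat.card_congr
    ((Subspace.orderIsoFiniteDimensional.toEquiv.trans OrderDual.ofDual).subtypeEquiv fun W => ?_)
  have := Subspace.finrank_add_finrank_dualAnnihilator_eq W
  change finrank K W = n ↔ finrank K W.dualAnnihilator = 1
  omega

/-- Subspaces containing a point correspond to subspaces of the quotient by it. -/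
theorem card_finrank_eq_two_of_le {K V : Type*} [Field K] [Finite K] [AddCommGroup V] [Module K V]
    [FiniteDimensional K V] {n : ℕ} (h : finrank K V = n + 1) (p : Submodule K V)
    (hp : finrank K p = 1) :
    Nat.card {l : {W : Submodule K V // finrank K W = 2} // p ≤ l.1} =
      ∑ i ∈ Finset.range n, Nat.card K ^ i := by
  have hq := p.finrank_quotient_add_finrank
  rw [← card_finrank_eq_one (K := K) (V := V ⧸ p) (by omega)]
  refine Nat.card_congr (Equiv.trans ?_ ((Submodule.comapMkQRelIso p).toEquiv.subtypeEquiv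
    (q := fun W => finrank K W.1 = 2) fun W => ?_).symm)
  · exact (Equiv.subtypeSubtypeEquivSubtypeInter _ _).trans
      ((Equiv.subtypeEquivRight fun _ => and_comm).trans
        (Equiv.subtypeSubtypeEquivSubtypeInter _ _).symm)
  · change finrank K W = 1 ↔ finrank K (W.comap p.mkQ) = 2
    have e := (Submodule.quotientQuotientEquivQuotient p (W.comap p.mkQ)
      (Submodule.le_comap_mkQ p W)).finrank_eq
    rw [Submodule.map_comap_eq_self (by simp)] at e
    have h₁ := W.finrank_quotient_add_finrank
    have h₂ := (W.comap p.mkQ).finrank_quotient_add_finrank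
    omega

theorem card_Pt : Fintype.card Pt = 13 := by
  rw [← Nat.card_eq_fintype_card, card_finrank_eq_one (n := 3) (by simp)]
  simp [Finset.sum_range_succ]

theorem card_Ln : Fintype.card Ln = 13 := by
  rw [← Nat.card_eq_fintype_card, card_finrank_add_one_eq (n := 2) (by simp)]
  simp [Finset.sum_range_succ]

theorem card_lines_through (p : Pt) : (Finset.univ.filter fun l : Ln => p.1 ≤ l.1).card = 4 := by
  rw [← Fintype.card_subtype, ← Nat.card_eq_fintype_card,
    card_finrank_eq_two_of_le (n := 2) (by simp) p.1 p.2]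
  simp [Finset.sum_range_succ]

theorem card_lines_through_two {p q : Pt} (hpq : p ≠ q) :
    (Finset.univ.filter fun l : Ln => p.1 ≤ l.1 ∧ q.1 ≤ l.1).card = 1 := by
  have hinf : p.1 ⊓ q.1 = ⊥ := by
    by_contra h
    have hpos := Submodule.one_le_finrank_iff.mpr h
    have h₁ := Submodule.eq_of_le_of_finrank_le (inf_le_left : p.1 ⊓ q.1 ≤ p.1)
      (by rw [p.2]; exact hpos)
    have h₂ := Submodule.eq_of_le_of_finrank_le (inf_le_right : p.1 ⊓ q.1 ≤ q.1)
      (by rw [q.2]; exact hpos)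
    exact hpq (Subtype.ext (h₁.symm.trans h₂))
  have hsup : finrank (ZMod 3) (p.1 ⊔ q.1 : Submodule (ZMod 3) (Fin 3 → ZMod 3)) = 2 := by
    have := Submodule.finrank_sup_add_finrank_inf_eq p.1 q.1
    rw [hinf, finrank_bot, p.2, q.2] at this
    exact this
  rw [Finset.card_eq_one]
  refine ⟨⟨p.1 ⊔ q.1, hsup⟩, Finset.ext fun l => ?_⟩
  simp only [Finset.mem_filter, Finset.mem_univ, true_and, Finset.mem_singleton, ← sup_le_iff]
  refine ⟨fun h => Subtype.ext (Submodule.eq_of_le_of_finrank_eq h (by rw [hsup, l.2])).symm, ?_⟩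
  rintro rfl
  exact le_rfl

/-- The incidence matrix of points and lines of `ℙ²(𝔽₃)`. -/
def incidence : Matrix Pt Ln ℂ := fun p l => if p.1 ≤ l.1 then 1 else 0

theorem neg_ite_zero {R : Type*} [Ring R] (P : Prop) [Decidable P] (a : R) :
    (-if P then a else 0) = if P then -a else 0 := by
  split_ifs <;> simp

theorem incidence_mul_transpose :
    incidence * incidence.transpose = (3 : ℂ) • 1 + Matrix.of fun _ _ => 1 := by
  ext p q
  have h : (incidence * incidence.transpose) p q =
      ((Finset.univ.filter fun l : Ln => p.1 ≤ l.1 ∧ q.1 ≤ l.1).card : ℂ) := by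
    simp [Matrix.mul_apply, incidence, ← ite_and, Finset.sum_boole, and_comm]
  rw [h]
  by_cases hpq : p = q
  · subst hpq
    simp only [and_self, card_lines_through]
    norm_num
  · simp [card_lines_through_two hpq, hpq]

theorem θ_mul_θ : θ * θ = -3 := by
  have h : ((Real.sqrt 3 : ℝ) : ℂ) * Real.sqrt 3 = 3 := by
    rw [← Complex.ofReal_mul, Real.mul_self_sqrt (by norm_num)]; norm_num
  rw [θ]
  linear_combination Complex.I * Complex.I * h + 3 * Complex.I_mul_I

theorem G_eq_fromBlocks :
    G = Matrix.fromBlocks ((3 : ℂ) • 1) (θ • incidence) (-θ • incidence.transpose)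
      ((3 : ℂ) • 1) := by
  ext (p | l) (q | m) <;> simp [G, incidence, Matrix.one_apply, neg_ite_zero]

theorem G_isHermitian : G.IsHermitian := by
  rw [G_eq_fromBlocks]
  refine Matrix.IsHermitian.ext ?_
  rintro (p | l) (q | m) <;>
    simp [incidence, Matrix.one_apply, eq_comm, apply_ite (starRingEnd ℂ), neg_ite_zero, θ,
      Complex.conj_ofNat]

/-- The determinant of `t I - c J`, where `J` is the all-ones matrix. -/
theorem det_smul_one_sub_ones {m : Type*} [Fintype m] [DecidableEq m] {t : ℂ} (ht : t ≠ 0)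
    (c : ℂ) :
    (t • (1 : Matrix m m ℂ) - c • Matrix.of fun _ _ => 1).det =
      t ^ Fintype.card m * (1 - c * Fintype.card m / t) := by
  have h : t • (1 : Matrix m m ℂ) - c • Matrix.of (fun _ _ => 1) =
      t • (1 + Matrix.replicateCol Unit (fun _ : m => -c / t) *
        Matrix.replicateRow Unit (fun _ : m => (1 : ℂ))) := by
    ext i j
    simp [Matrix.mul_apply, mul_add]
    field_simp
    ring
  rw [h, Matrix.det_smul, Matrix.det_one_add_replicateCol_mul_replicateRow]
  simp [dotProduct]
  left
  field_simp
  ring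

theorem eval_charpoly_G {x : ℂ} (h₃ : x ≠ 3) (h₀ : x * (x - 6) ≠ 0) :
    G.charpoly.eval x = (x * (x - 6)) ^ 12 * (x * (x - 6) - 39) := by
  have hy : x - 3 ≠ 0 := sub_ne_zero.mpr h₃
  let : Invertible ((x - 3) • (1 : Matrix Ln Ln ℂ)) :=
    ⟨(x - 3)⁻¹ • 1, by simp [hy], by simp [hy]⟩
  have hb : Matrix.scalar (Pt ⊕ Ln) x - G = Matrix.fromBlocks ((x - 3) • 1) (-θ • incidence)
      (θ • incidence.transpose) ((x - 3) • 1) := by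
    rw [G_eq_fromBlocks]
    ext (p | l) (q | m) <;> simp [Matrix.one_apply, Matrix.diagonal_apply] <;> split_ifs <;> simp
  have hs : (x - 3) • (1 : Matrix Pt Pt ℂ) - -θ • incidence * (x - 3)⁻¹ • (1 : Matrix Ln Ln ℂ) *
      θ • incidence.transpose =
      (x - 3)⁻¹ • ((x * (x - 6)) • 1 - (3 : ℂ) • Matrix.of fun _ _ => 1) := by
    simp only [Matrix.smul_mul, Matrix.mul_smul, Matrix.mul_one, incidence_mul_transpose, smul_smul]
    ext p q
    simp only [Matrix.sub_apply, Matrix.add_apply, Matrix.smul_apply, Matrix.of_apply, smul_eq_mul]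
    field_simp
    linear_combination (3 * (1 : Matrix Pt Pt ℂ) p q + 1) * θ_mul_θ
  rw [Matrix.eval_charpoly, hb, Matrix.det_fromBlocks₂₂]
  change _ * Matrix.det ((x - 3) • (1 : Matrix Pt Pt ℂ) - -θ • incidence *
    (x - 3)⁻¹ • (1 : Matrix Ln Ln ℂ) * θ • incidence.transpose) = _
  rw [hs, Matrix.det_smul, Matrix.det_smul, det_smul_one_sub_ones h₀, card_Pt, card_Ln,
    Matrix.det_one]
  have h₀₁ := left_ne_zero_of_mul h₀
  have h₀₂ := right_ne_zero_of_mul h₀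
  field_simp
  norm_num

/-- The spectrum of `G`, with multiplicities. -/
def spectrumG : Multiset ℝ :=
  12 • {0} + 12 • {6} + {3 + 4 * Real.sqrt 3} + {3 - 4 * Real.sqrt 3}

theorem charpoly_G : G.charpoly = ((spectrumG.map Complex.ofReal).map fun a => X - C a).prod := by
  refine eq_of_infinite_eval_eq _ _ ((Set.toFinite ({0, 3, 6} : Set ℂ)).infinite_compl.mono ?_)
  intro x hx
  simp only [Set.mem_compl_iff, Set.mem_insert_iff, Set.mem_singleton_iff, not_or] at hx
  obtain ⟨h0, h3, h6⟩ := hx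
  have h : ((Real.sqrt 3 : ℝ) : ℂ) * Real.sqrt 3 = 3 := by
    rw [← Complex.ofReal_mul, Real.mul_self_sqrt (by norm_num)]; norm_num
  rw [Set.mem_ofPred_eq, eval_charpoly_G h3 (mul_ne_zero h0 (sub_ne_zero.mpr h6))]
  simp only [spectrumG, Multiset.map_add, Multiset.map_nsmul, Multiset.map_singleton,
    Multiset.prod_add, Multiset.prod_nsmul, Multiset.prod_singleton]
  simp
  linear_combination (16 * x ^ 12 * (x - 6) ^ 12) * h

theorem eigenvalues_G (hH : G.IsHermitian) :
    Finset.univ.val.map hH.eigenvalues = spectrumG := by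
  refine Multiset.map_injective Complex.ofReal_injective ?_
  have h := hH.roots_charpoly_eq_eigenvalues
  rw [charpoly_G, Polynomial.roots_multiset_prod_X_sub_C] at h
  rw [h, Multiset.map_map]
  rfl

theorem card_filter_eigenvalues_G (hH : G.IsHermitian) (P : ℝ → Prop) [DecidablePred P] :
    (Finset.univ.filter fun i => P (hH.eigenvalues i)).card = (spectrumG.filter P).card := by
  rw [← eigenvalues_G hH, Multiset.filter_map, Multiset.card_map]
  rfl

/-- The `26 × 26` Hermitian matrix `G(I_26)` has rank `14` and,
counted with multiplicity, exactly `13` of its (necessarily real) eigenvalues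
are positive, exactly `1` is negative, and exactly `12` are zero. -/
theorem G_I26_rank_and_signature :
    ∃ hH : G.IsHermitian,
      G.rank = 14 ∧
      (Finset.univ.filter fun i => 0 < hH.eigenvalues i).card = 13 ∧
      (Finset.univ.filter fun i => hH.eigenvalues i < 0).card = 1 ∧
      (Finset.univ.filter fun i => hH.eigenvalues i = 0).card = 12 := by
  have h₁ : 0 < 3 + 4 * Real.sqrt 3 := by positivity
  have h₂ : 3 - 4 * Real.sqrt 3 < 0 := by
    have : 1 < Real.sqrt 3 := Real.lt_sqrt_of_sq_lt (by norm_num)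
    linarith
  refine ⟨G_isHermitian, ?_, ?_, ?_, ?_⟩
  · rw [G_isHermitian.rank_eq_card_non_zero_eigs, Fintype.card_subtype,
      card_filter_eigenvalues_G _ (· ≠ 0)]
    simp [spectrumG, Multiset.filter_nsmul, Multiset.filter_singleton, h₁.ne', h₂.ne]
  · rw [card_filter_eigenvalues_G _ (0 < ·)]
    simp [spectrumG, Multiset.filter_nsmul, Multiset.filter_singleton, h₁, h₂.not_gt]
  · rw [card_filter_eigenvalues_G _ (· < 0)]
    simp [spectrumG, Multiset.filter_nsmul, Multiset.filter_singleton, h₁.not_gt, h₂]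
  · rw [card_filter_eigenvalues_G _ (· = 0)]
    simp [spectrumG, Multiset.filter_nsmul, Multiset.filter_singleton, h₁.ne', h₂.ne]

end

end AllcockStmt11
end

section
/- The real symmetric 26 × 26 matrix M has rank 14 and, counted with multiplicity, exactly 13 of its eigenvalues are positive, exactly 1 is negative, and exactly 12 are zero. (The real span of the rescaled root vectors of L(I_26) is a Lorentzian space of dimension 14, supporting the 26-cell.) -/
open scoped Classical

namespace AllcockStmt15

noncomputable section

/-- The points of the projective plane `ℙ²(𝔽₃)`. -/
abbrev Pt := {W : Submodule (ZMod 3) (Fin 3 → ZMod 3) // Module.finrank (ZMod 3) W = 1}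

/-- The lines of the projective plane `ℙ²(𝔽₃)`. -/
abbrev Ln := {W : Submodule (ZMod 3) (Fin 3 → ZMod 3) // Module.finrank (ZMod 3) W = 2}

instance : DecidableEq Pt := Classical.decEq _
instance : DecidableEq Ln := Classical.decEq _

/-- The real symmetric `26 × 26` matrix `M` indexed by `P ⊔ L`: diagonal
entries `3`, entries `-√3` for every incident pair, all other entries `0`. -/
def M : Matrix (Pt ⊕ Ln) (Pt ⊕ Ln) ℝ := fun u v =>
  match u, v with
  | Sum.inl p, Sum.inl q => if p = q then 3 else 0
  | Sum.inl p, Sum.inr l => if p.1 ≤ l.1 then -Real.sqrt 3 else 0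
  | Sum.inr l, Sum.inl p => if p.1 ≤ l.1 then -Real.sqrt 3 else 0
  | Sum.inr l, Sum.inr m => if l = m then 3 else 0

section ProjectivePlane

open Configuration Matrix

variable (P L : Type*) [Membership P L]

/-- The point-line incidence matrix of a configuration. -/
def incidence : Matrix P L ℝ := of fun p l => if p ∈ l then 1 else 0

variable [ProjectivePlane P L] [Fintype P] [Fintype L]

theorem incidence_mul_transpose :
    incidence P L * (incidence P L)ᵀ =
      (ProjectivePlane.order P L : ℝ) • (1 : Matrix P P ℝ) + of fun _ _ => 1 := by
  ext p q
  have h : (incidence P L * (incidence P L)ᵀ) p q = Nat.card {l : L // p ∈ l ∧ q ∈ l} := by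
    simp [incidence, mul_apply, Fintype.card_subtype, ← ite_and, and_comm]
  rw [h]
  by_cases hpq : p = q
  · subst hpq
    have := ProjectivePlane.lineCount_eq L p
    rw [lineCount] at this
    simp only [and_self, this]
    simp
  · obtain ⟨l, hl, hu⟩ := HasLines.existsUnique_line P L p q hpq
    have : Nat.card {l : L // p ∈ l ∧ q ∈ l} = 1 :=
      Nat.card_eq_one_iff_exists.2 ⟨⟨l, hl⟩, fun m => Subtype.ext (hu m.1 m.2)⟩
    rw [this]
    simp [hpq]

theorem transpose_mul_incidence :
    (incidence P L)ᵀ * incidence P L =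
      (ProjectivePlane.order P L : ℝ) • (1 : Matrix L L ℝ) + of fun _ _ => 1 := by
  rw [← ProjectivePlane.Dual.order P L]
  exact incidence_mul_transpose (Dual L) (Dual P)

end ProjectivePlane

section Subspaces

open Configuration Module

instance : Membership Pt Ln := ⟨fun l p => p.1 ≤ l.1⟩

theorem mem_line_iff {p : Pt} {l : Ln} : p ∈ l ↔ p.1 ≤ l.1 := Iff.rfl

/-- The point spanned by a nonzero vector. -/
def spanPoint (v : Fin 3 → ZMod 3) (hv : v ≠ 0) : Pt :=
  ⟨Submodule.span (ZMod 3) {v}, finrank_span_singleton hv⟩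

/-- The coordinate line where the `i`-th coordinate vanishes. -/
def coordLine (i : Fin 3) : Ln :=
  ⟨LinearMap.ker (LinearMap.proj i : (Fin 3 → ZMod 3) →ₗ[ZMod 3] ZMod 3), by
    have h := LinearMap.finrank_range_add_finrank_ker
      (LinearMap.proj i : (Fin 3 → ZMod 3) →ₗ[ZMod 3] ZMod 3)
    rw [LinearMap.range_eq_top.2 (LinearMap.proj_surjective i)] at h
    simp only [finrank_top, finrank_self, finrank_fin_fun] at h
    omega⟩

theorem spanPoint_mem_iff {v : Fin 3 → ZMod 3} {hv : v ≠ 0} {l : Ln} :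
    spanPoint v hv ∈ l ↔ v ∈ l.1 := by
  simp [mem_line_iff, spanPoint]

theorem spanPoint_mem_coordLine_iff {v : Fin 3 → ZMod 3} {hv : v ≠ 0} {i : Fin 3} :
    spanPoint v hv ∈ coordLine i ↔ v i = 0 := by
  simp [spanPoint_mem_iff, coordLine]

theorem exists_spanPoint_eq (p : Pt) : ∃ v hv, spanPoint v hv = p := by
  obtain ⟨v, hv, h⟩ := finrank_eq_one_iff'.1 p.2
  refine ⟨v, by simpa using hv, Subtype.ext (Submodule.eq_of_le_of_finrank_eq ?_ ?_)⟩
  · simp [spanPoint]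
  · rw [(spanPoint _ _).2, p.2]

theorem finrank_sup_of_ne {p q : Pt} (h : p ≠ q) : finrank (ZMod 3) ↥(p.1 ⊔ q.1) = 2 := by
  have h₁ := Submodule.finrank_sup_add_finrank_inf_eq p.1 q.1
  have h₂ : finrank (ZMod 3) ↥(p.1 ⊓ q.1) < finrank (ZMod 3) p.1 := by
    refine Submodule.finrank_lt_finrank_of_lt (inf_lt_left.2 fun hle => h ?_)
    exact Subtype.ext (Submodule.eq_of_le_of_finrank_eq hle (p.2.trans q.2.symm))
  have := p.2
  have := q.2
  omega

theorem finrank_inf_of_ne {l m : Ln} (h : l ≠ m) : finrank (ZMod 3) ↥(l.1 ⊓ m.1) = 1 := by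
  have h₁ := Submodule.finrank_sup_add_finrank_inf_eq l.1 m.1
  have h₂ : finrank (ZMod 3) l.1 < finrank (ZMod 3) ↥(l.1 ⊔ m.1) := by
    refine Submodule.finrank_lt_finrank_of_lt (left_lt_sup.2 fun hle => h ?_)
    exact Subtype.ext (Submodule.eq_of_le_of_finrank_eq hle (m.2.trans l.2.symm)).symm
  have h₃ := Submodule.finrank_le (l.1 ⊔ m.1)
  rw [finrank_fin_fun] at h₃
  have := l.2
  have := m.2
  omega

instance : ProjectivePlane Pt Ln where
  exists_point l := by
    have hl : l.1 ≠ ⊤ := fun h => by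
      have := l.2
      rw [h, finrank_top, finrank_fin_fun] at this
      omega
    obtain ⟨v, -, hv⟩ := SetLike.exists_of_lt hl.lt_top
    exact ⟨spanPoint v fun h => hv (h ▸ l.1.zero_mem), spanPoint_mem_iff.not.2 hv⟩
  exists_line p := by
    obtain ⟨v, hv, rfl⟩ := exists_spanPoint_eq p
    obtain ⟨i, hi⟩ := Function.ne_iff.1 hv
    exact ⟨coordLine i, spanPoint_mem_coordLine_iff.not.2 hi⟩
  eq_or_eq {p q l m} h₁ h₂ h₃ h₄ := by
    refine or_iff_not_imp_left.2 fun h => Subtype.ext ?_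
    have h₅ := finrank_sup_of_ne h
    exact (Submodule.eq_of_le_of_finrank_eq (sup_le h₁ h₂) (h₅.trans l.2.symm)).symm.trans
      (Submodule.eq_of_le_of_finrank_eq (sup_le h₃ h₄) (h₅.trans m.2.symm))
  mkPoint h := ⟨_, finrank_inf_of_ne h⟩
  mkPoint_ax _ := ⟨inf_le_left, inf_le_right⟩
  mkLine h := ⟨_, finrank_sup_of_ne h⟩
  mkLine_ax _ := ⟨le_sup_left, le_sup_right⟩
  exists_config := by
    refine ⟨spanPoint ![0, 1, 1] ?_, spanPoint ![1, 0, 0] ?_, spanPoint ![1, 0, 1] ?_,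
      coordLine 0, coordLine 1, coordLine 2, ?_⟩ <;> simp [spanPoint_mem_coordLine_iff]

theorem card_points [Fintype Pt] : Fintype.card Pt = 13 := by
  rw [← Nat.card_eq_fintype_card,
    ← Nat.card_congr (Projectivization.equivSubmodule (ZMod 3) (Fin 3 → ZMod 3)),
    Projectivization.card_of_finrank (ZMod 3) _ (finrank_fin_fun (ZMod 3))]
  simp [Finset.sum_range_succ]

theorem order_eq_three : ProjectivePlane.order Pt Ln = 3 := by
  have h := ProjectivePlane.card_points Pt Ln
  rw [card_points] at h
  nlinarith

theorem card_lines [Fintype Ln] : Fintype.card Ln = 13 := by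
  simp [ProjectivePlane.card_lines Pt Ln, order_eq_three]

end Subspaces

section Spectrum

open Matrix Polynomial

theorem M_eq_fromBlocks :
    M = fromBlocks ((3 : ℝ) • 1) (-√3 • incidence Pt Ln) (-√3 • (incidence Pt Ln)ᵀ)
      ((3 : ℝ) • 1) := by
  ext (p | l) (q | m) <;> simp [M, incidence, one_apply, mem_line_iff, apply_ite]

theorem M_isHermitian : M.IsHermitian := by
  rw [M_eq_fromBlocks]
  refine IsHermitian.fromBlocks ?_ ?_ ?_ <;> ext <;> simp [one_apply, eq_comm]

/-- The block diagonal matrix with all-ones diagonal blocks. -/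
def blockOnes (m n : Type*) : Matrix (m ⊕ n) (m ⊕ n) ℝ :=
  fromBlocks (of fun _ _ => 1) 0 0 (of fun _ _ => 1)

theorem blockOnes_mul_self : blockOnes Pt Ln * blockOnes Pt Ln = (13 : ℝ) • blockOnes Pt Ln := by
  ext (p | l) (q | m) <;>
    simp [blockOnes, mul_apply, card_points, card_lines]

theorem M_sub_three_mul_self :
    (M - (3 : ℝ) • 1) * (M - (3 : ℝ) • 1) = (9 : ℝ) • 1 + (3 : ℝ) • blockOnes Pt Ln := by
  have h : M - (3 : ℝ) • 1 =
      fromBlocks 0 (-√3 • incidence Pt Ln) (-√3 • (incidence Pt Ln)ᵀ) 0 := by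
    rw [M_eq_fromBlocks, ← fromBlocks_one, fromBlocks_smul, sub_eq_add_neg, fromBlocks_neg,
      fromBlocks_add]
    simp
  rw [h, fromBlocks_multiply, blockOnes, ← fromBlocks_one, fromBlocks_smul, fromBlocks_smul,
    fromBlocks_add]
  simp only [Matrix.zero_mul, Matrix.mul_zero, zero_add, add_zero, Matrix.smul_mul,
    Matrix.mul_smul, smul_smul, smul_zero, incidence_mul_transpose, transpose_mul_incidence,
    order_eq_three, smul_add, neg_mul_neg, ← mul_assoc,
    Real.mul_self_sqrt (by norm_num : (0 : ℝ) ≤ 3)]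
  norm_num [← mul_assoc]

theorem trace_M : M.trace = 78 := by
  simp only [trace, diag_apply, Fintype.sum_sum_type, M, if_true, Finset.sum_const,
    Finset.card_univ, card_points, card_lines]
  norm_num

theorem trace_M_sq : (M ^ 2).trace = 546 := by
  have h : M ^ 2 = (M - (3 : ℝ) • 1) * (M - (3 : ℝ) • 1) + (6 : ℝ) • M - (9 : ℝ) • 1 := by
    simp only [sub_mul, mul_sub, smul_mul_assoc, mul_smul_comm, one_mul, mul_one, pow_two]
    module
  rw [h, M_sub_three_mul_self, trace_sub, trace_add, trace_add, trace_smul, trace_smul, trace_smul,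
    trace_M, trace_one, Fintype.card_sum, card_points, card_lines]
  simp only [trace, diag_apply, Fintype.sum_sum_type, blockOnes, fromBlocks_apply₁₁,
    fromBlocks_apply₂₂, of_apply, Finset.sum_const, Finset.card_univ, card_points, card_lines]
  norm_num

theorem M_annihilated :
    aeval M (((X - C 3) ^ 2 - C 9) * ((X - C 3) ^ 2 - C 48) : ℝ[X]) = 0 := by
  simp only [map_mul, map_sub, map_pow, aeval_X, aeval_C, Algebra.algebraMap_eq_smul_one]
  rw [pow_two, M_sub_three_mul_self]
  simp only [sub_mul, mul_sub, add_mul, mul_add, smul_mul_assoc, mul_smul_comm, one_mul, mul_one, smul_smul,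
    blockOnes_mul_self]
  module

theorem eigenvalues_M (h : M.IsHermitian) (i : Pt ⊕ Ln) :
    h.eigenvalues i = 0 ∨ h.eigenvalues i = 6 ∨ h.eigenvalues i = 3 + 4 * √3 ∨
      h.eigenvalues i = 3 - 4 * √3 := by
  have h₁ := spectrum.subset_polynomial_aeval M
    (((X - C 3) ^ 2 - C 9) * ((X - C 3) ^ 2 - C 48) : ℝ[X])
    ⟨_, h.eigenvalues_mem_spectrum_real i, rfl⟩
  have : Nonempty (Pt ⊕ Ln) := ⟨i⟩
  rw [M_annihilated, spectrum.zero_eq] at h₁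
  set x := h.eigenvalues i
  have h₃ : √3 * √3 = 3 := Real.mul_self_sqrt (by norm_num)
  have h₂ : x * ((x - 6) * ((x - (3 + 4 * √3)) * (x - (3 - 4 * √3)))) = 0 := by
    have : ((x - 3) ^ 2 - 9) * ((x - 3) ^ 2 - 48) = 0 := by simpa using h₁
    linear_combination this - 16 * x * (x - 6) * h₃
  simpa [sub_eq_zero] using h₂

theorem trace_sq_eq_sum_eigenvalues_sq {n : Type*} [Fintype n] [DecidableEq n]
    {A : Matrix n n ℝ} (hA : A.IsHermitian) : (A ^ 2).trace = ∑ i, hA.eigenvalues i ^ 2 := by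
  conv_lhs => rw [hA.spectral_theorem, ← map_pow]
  rw [Unitary.conjStarAlgAut_apply, trace_mul_comm, ← mul_assoc]
  simp [diagonal_pow, trace_diagonal]

end Spectrum

/-- The real symmetric `26 × 26` matrix `M` has rank `14` and,
counted with multiplicity, exactly `13` of its eigenvalues are positive,
exactly `1` is negative, and exactly `12` are zero. -/
theorem M_rank_and_signature :
    ∃ hH : M.IsHermitian,
      M.rank = 14 ∧
      (Finset.univ.filter fun i => 0 < hH.eigenvalues i).card = 13 ∧
      (Finset.univ.filter fun i => hH.eigenvalues i < 0).card = 1 ∧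
      (Finset.univ.filter fun i => hH.eigenvalues i = 0).card = 12 := by
  refine ⟨M_isHermitian, ?_⟩
  rw [M_isHermitian.rank_eq_card_non_zero_eigs, Fintype.card_subtype]
  set e := M_isHermitian.eigenvalues with he
  have hs : √3 * √3 = 3 := Real.mul_self_sqrt (by norm_num)
  have hs₁ : 1 < √3 := Real.lt_sqrt_of_sq_lt (by norm_num)
  have hsum (f : ℝ → ℝ) : ∑ i, f (e i) =
      (Finset.univ.filter fun i => e i = 0).card * f 0 +
      (Finset.univ.filter fun i => e i = 6).card * f 6 +
      (Finset.univ.filter fun i => e i = 3 + 4 * √3).card * f (3 + 4 * √3) +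
      (Finset.univ.filter fun i => e i = 3 - 4 * √3).card * f (3 - 4 * √3) := by
    simp only [← Finset.sum_boole, Finset.sum_mul, ← Finset.sum_add_distrib]
    have h₁ : 3 + 4 * √3 ≠ 0 := by linarith
    have h₂ : 3 - 4 * √3 ≠ 0 := by linarith
    have h₃ : 3 + 4 * √3 ≠ 6 := by linarith
    have h₄ : 3 - 4 * √3 ≠ 6 := by linarith
    have h₅ : 3 + 4 * √3 ≠ 3 - 4 * √3 := by linarith
    refine Finset.sum_congr rfl fun i _ => ?_
    rcases eigenvalues_M M_isHermitian i with h | h | h | h <;> rw [← he] at h <;> rw [h] <;>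
      simp [h₁, h₂, h₃, h₄, h₅, h₁.symm, h₂.symm, h₃.symm, h₄.symm, h₅.symm]
  have hcount (q : ℝ → Prop) [DecidablePred q] :
      ((Finset.univ.filter fun i => q (e i)).card : ℝ) = _ :=
    (Finset.sum_boole _ _).symm.trans (hsum fun x => if q x then 1 else 0)
  have hcard := hsum fun _ => 1
  have htrace := hsum id
  have hsq := hsum fun x => x ^ 2
  have hpos := hcount (0 < ·)
  have hneg := hcount (· < 0)
  have hne := hcount (· ≠ 0)
  have h₁ : 0 < 3 + 4 * √3 := by linarith
  have h₂ : 3 - 4 * √3 < 0 := by linarith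
  rw [← trace_sq_eq_sum_eigenvalues_sq, trace_M_sq] at hsq
  have ht : M.trace = ∑ i, e i := M_isHermitian.trace_eq_sum_eigenvalues
  rw [trace_M] at ht
  simp only [id, ← ht] at htrace
  simp only [Finset.sum_const, Finset.card_univ, Fintype.card_sum, card_points, card_lines,
    nsmul_eq_mul, mul_one] at hcard
  simp only [h₁, h₂, h₁.ne', h₂.ne, h₁.not_gt, h₂.not_gt, lt_irrefl, ne_eq, not_true_eq_false,
    not_false_eq_true, if_true, if_false, mul_zero, mul_one, zero_add, add_zero, Nat.ofNat_pos,
    OfNat.ofNat_ne_zero, show ¬ (6 : ℝ) < 0 by norm_num] at hpos hneg hne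
  simp only [ne_eq]
  generalize (Finset.univ.filter fun i => e i = 0).card = a at *
  generalize (Finset.univ.filter fun i => e i = 6).card = b at *
  generalize (Finset.univ.filter fun i => e i = 3 + 4 * √3).card = c at *
  generalize (Finset.univ.filter fun i => e i = 3 - 4 * √3).card = d at *
  norm_cast at hpos hneg hne hcard
  rw [hpos, hneg, hne]
  have hcard' : (26 : ℝ) = a + b + c + d := mod_cast hcard
  have hcd : c + d = 2 := by
    have : (c : ℝ) + d = 2 := by
      linear_combination -(1 / 39) * (hsq - 6 * htrace) - (16 / 39) * (c + d) * hs
    exact_mod_cast this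
  have hcd' : (c : ℝ) + d = 2 := mod_cast hcd
  have hsquare : 48 * ((c : ℝ) - d) ^ 2 = 9 * ((a : ℝ) - b) ^ 2 := by
    have : 4 * √3 * ((c : ℝ) - d) = 3 * (a - b) := by
      linear_combination 3 * hcard' - htrace
    linear_combination (4 * √3 * ((c : ℝ) - d) + 3 * (a - b)) * this - 16 * ((c : ℝ) - d) ^ 2 * hs
  have hsquare' : 48 * ((c : ℤ) - d) ^ 2 = 9 * ((a : ℤ) - b) ^ 2 := mod_cast hsquare
  have hc : c = 1 := by
    have : c ≤ 2 := by omega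
    interval_cases c
    · obtain rfl : d = 2 := by omega
      norm_num at hsquare'
      omega
    · rfl
    · obtain rfl : d = 0 := by omega
      norm_num at hsquare'
      omega
  obtain rfl : d = 1 := by omega
  subst hc
  have : (a : ℤ) - b = 0 := by simpa using hsquare'
  omega

end

end AllcockStmt15
end

section
/- If the Hermitian matrix M(x, y, z, w) is positive definite, then x = y = z = w = 0. (The paper's Lemma: any positive definite Eisenstein lattice of rank 5 containing L(A_4) as a primitive sublattice and spanned by L(A_4) and a complementary root is the orthogonal direct sum L(A_4) ⊕ L(A_1).) -/
open scoped ComplexOrder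

/-- The norm form of the Eisenstein integers is nonnegative. -/
lemma eisenstein_norm_form_nonneg (p q : ℤ) : 0 ≤ p^2 - p*q + q^2 := by
  nlinarith [sq_nonneg (p - q), sq_nonneg p, sq_nonneg q]

/-- The norm form of the Eisenstein integers is anisotropic. -/
lemma eisenstein_norm_eq_zero {p q : ℤ} (hpq : p^2 - p*q + q^2 ≤ 0) : p = 0 ∧ q = 0 := by
  constructor
  · exact pow_eq_zero_iff two_ne_zero |>.mp
      (le_antisymm (by nlinarith [sq_nonneg (p - 2*q)]) (sq_nonneg p))
  · exact pow_eq_zero_iff two_ne_zero |>.mp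
      (le_antisymm (by nlinarith [sq_nonneg (2*p - q)]) (sq_nonneg q))

/-- A positive definite integral form in eight variables (a copy of `E₈`, halved) with values
smaller than `1` only at the origin. -/
lemma eq_zero_of_eisenstein_form_lt_one (a b c d e f g h : ℤ)
    (hN : (a^2 - a*b + b^2) + 2*(c^2 - c*d + d^2) + 2*(e^2 - e*f + f^2) + (g^2 - g*h + h^2)
      + 2*(a*d - b*c) - (2*a*e + 2*b*f - a*f - b*e) - (a*h - b*g) + 3*(c*f - d*e)
      - (2*c*g + 2*d*h - c*h - d*g) + 2*(e*h - f*g) < 1) :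
    (a = 0 ∧ b = 0) ∧ (c = 0 ∧ d = 0) ∧ (e = 0 ∧ f = 0) ∧ (g = 0 ∧ h = 0) := by
  obtain ⟨p, hp⟩ : ∃ p, p = 3*a - 2*(c - 2*d) - 3*e + (g - 2*h) := ⟨_, rfl⟩
  obtain ⟨q, hq⟩ : ∃ q, q = 3*b - 2*(2*c - d) - 3*f + (2*g - h) := ⟨_, rfl⟩
  obtain ⟨r, hr⟩ : ∃ r, r = 2*c - (e - 2*f) - g := ⟨_, rfl⟩
  obtain ⟨s, hs⟩ : ∃ s, s = 2*d - (2*e - f) - h := ⟨_, rfl⟩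
  obtain ⟨t, ht⟩ : ∃ t, t = 3*e - (g - 2*h) := ⟨_, rfl⟩
  obtain ⟨u, hu⟩ : ∃ u, u = 3*f - (2*g - h) := ⟨_, rfl⟩
  have hsum : 2*(p^2 - p*q + q^2) + 3*(r^2 - r*s + s^2) + (t^2 - t*u + u^2)
      + 6*(g^2 - g*h + h^2) ≤ 0 := by
    subst hp hq hr hs ht hu
    linarith
  have h₁ := eisenstein_norm_form_nonneg p q
  have h₂ := eisenstein_norm_form_nonneg r s
  have h₃ := eisenstein_norm_form_nonneg t u
  have h₄ := eisenstein_norm_form_nonneg g h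
  obtain ⟨hp₀, hq₀⟩ := eisenstein_norm_eq_zero (show p^2 - p*q + q^2 ≤ 0 by linarith)
  obtain ⟨hr₀, hs₀⟩ := eisenstein_norm_eq_zero (show r^2 - r*s + s^2 ≤ 0 by linarith)
  obtain ⟨ht₀, hu₀⟩ := eisenstein_norm_eq_zero (show t^2 - t*u + u^2 ≤ 0 by linarith)
  obtain ⟨hg₀, hh₀⟩ := eisenstein_norm_eq_zero (show g^2 - g*h + h^2 ≤ 0 by linarith)
  clear hN hsum h₁ h₂ h₃ h₄
  omega

/-- If the `5 × 5` Hermitian matrix `M(x, y, z, w)` (the Gram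
matrix of a rank `5` Eisenstein lattice containing `L(A_4)` spanned by `L(A_4)`
and a complementary root, with `x, y, z, w` Eisenstein integers) is positive
definite, then `x = y = z = w = 0`. -/
theorem eisenstein_rank_five_lemma
    (ω θ : ℂ)
    (hω : ω = (-1 + Complex.I * Real.sqrt 3) / 2)
    (hθ : θ = Complex.I * Real.sqrt 3)
    (x y z w : ℂ)
    (hx : ∃ a b : ℤ, x = (a : ℂ) + (b : ℂ) * ω)
    (hy : ∃ a b : ℤ, y = (a : ℂ) + (b : ℂ) * ω)
    (hz : ∃ a b : ℤ, z = (a : ℂ) + (b : ℂ) * ω)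
    (hw : ∃ a b : ℤ, w = (a : ℂ) + (b : ℂ) * ω)
    (M : Matrix (Fin 5) (Fin 5) ℂ)
    (hM : M = !![3, θ, 0, 0, x * θ;
                 -θ, 3, θ, 0, y * θ;
                 0, -θ, 3, θ, z * θ;
                 0, 0, -θ, 3, w * θ;
                 -(starRingEnd ℂ x) * θ, -(starRingEnd ℂ y) * θ,
                   -(starRingEnd ℂ z) * θ, -(starRingEnd ℂ w) * θ, 3])
    (hpos : M.PosDef) :
    x = 0 ∧ y = 0 ∧ z = 0 ∧ w = 0 := by
  obtain ⟨a, b, hx⟩ := hx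
  obtain ⟨c, d, hy⟩ := hy
  obtain ⟨e, f, hz⟩ := hz
  obtain ⟨g, h, hw⟩ := hw
  have hs : √3 * √3 = (3 : ℝ) := Real.mul_self_sqrt (by norm_num)
  have hθ2 : θ * θ = -3 := by
    rw [hθ]
    apply Complex.ext <;> simp [hs]
  set c₁ := θ * x + 2 * y - θ * z - w with hc₁
  set c₂ := -2 * x + 2 * θ * y + 3 * z - θ * w with hc₂
  set c₃ := -θ * x - 3 * y + 2 * θ * z + 2 * w with hc₃
  set c₄ := x - θ * y - 2 * z + θ * w with hc₄
  have hMu : M.mulVec ![-c₁, -c₂, -c₃, -c₄, 1] = ![0, 0, 0, 0,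
      3 + θ * (starRingEnd ℂ x * c₁ + starRingEnd ℂ y * c₂ + starRingEnd ℂ z * c₃
        + starRingEnd ℂ w * c₄)] := by
    rw [hM]
    ext i
    fin_cases i <;> simp [Matrix.mulVec, dotProduct, Fin.sum_univ_five, hc₁, hc₂, hc₃, hc₄]
    · linear_combination (-2 * y + w) * hθ2
    · linear_combination (2 * x - 3 * z) * hθ2
    · linear_combination (3 * y - 2 * w) * hθ2
    · linear_combination (-x + 2 * z) * hθ2
    · ring
  obtain ⟨N, hN⟩ : ∃ N : ℤ, N = (a^2 - a*b + b^2) + 2*(c^2 - c*d + d^2)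
      + 2*(e^2 - e*f + f^2) + (g^2 - g*h + h^2)
      + 2*(a*d - b*c) - (2*a*e + 2*b*f - a*f - b*e) - (a*h - b*g) + 3*(c*f - d*e)
      - (2*c*g + 2*d*h - c*h - d*g) + 2*(e*h - f*g) := ⟨_, rfl⟩
  have hθω : θ = 1 + 2 * ω := by rw [hθ, hω]; ring
  have hω2 : ω * ω = -1 - ω := by
    rw [hθω] at hθ2
    linear_combination hθ2 / 4
  have hconj : starRingEnd ℂ ω = -1 - ω := by
    rw [hω]
    simp only [map_div₀, map_add, map_neg, map_one, map_mul, Complex.conj_I, Complex.conj_ofReal,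
      map_ofNat]
    ring
  have hschur : 3 + θ * (starRingEnd ℂ x * c₁ + starRingEnd ℂ y * c₂ + starRingEnd ℂ z * c₃
      + starRingEnd ℂ w * c₄) = ((3 - 3 * N : ℤ) : ℂ) := by
    simp only [hc₁, hc₂, hc₃, hc₄, hx, hy, hz, hw, hθω, hN, map_add, map_mul, map_intCast, hconj]
    push_cast
    clear hM hMu hpos hω hθ hθω hθ2 hconj hN hx hy hz hw
    grind
  have hne : ![-c₁, -c₂, -c₃, -c₄, 1] ≠ 0 := fun h0 => by simpa using congrFun h0 4
  have hlt : 0 < ((3 - 3 * N : ℤ) : ℂ) := by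
    simpa [hMu, hschur, dotProduct, Fin.sum_univ_five] using hpos.dotProduct_mulVec_pos hne
  have hN1 : N < 1 := by
    have : 0 < 3 - 3 * N := by exact_mod_cast hlt
    linarith
  have hzero := eq_zero_of_eisenstein_form_lt_one a b c d e f g h (hN ▸ hN1)
  obtain ⟨⟨rfl, rfl⟩, ⟨rfl, rfl⟩, ⟨rfl, rfl⟩, rfl, rfl⟩ := hzero
  simp [hx, hy, hz, hw]
end
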